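/- arXiv:2311.11681 — 2 statements merged into one kernel-verified Lean document; each statement's English description precedes it below -/
import Mathlib

section
/- Consider the DPPD dynamics without line-limit constraints: let κ ∈ (0,1) and let η, d, ω, μ, θ̂ : [0,∞) → ℝⁿ and P : [0,∞) → ℝˡ be continuously differentiable and satisfy, for all t ≥ 0, with u₁(t) = P^in − d(t) − Dω(t) − CP(t) and u₂(t) = P^in − d(t) − C B Cᵀ θ̂(t): η′ᵢ = prox_{f_{i,2}}(dᵢ − κηᵢ) − dᵢ; d′ᵢ = proj_{Ωᵢ}(dᵢ − f_{i,0}'(dᵢ) + κηᵢ + ωᵢ + u₁ᵢ + μᵢ + u₂ᵢ) − dᵢ; θ̂′ = C B Cᵀ(μ + u₂); P′ = Cᵀ(ω + u₁); ω′ = (1/2)u₁; μ′ = (1/2)u₂; with d(0) ∈ Ω. Assume there exist d̃ with d̲ᵢ < d̃ᵢ < d̄ᵢ for all i and θ̃ ∈ ℝⁿ with P^in − d̃ − C B Cᵀ θ̃ = 0. Then the trajectory (η(t), d(t), θ̂(t), P(t), ω(t), μ(t)) is bounded on [0,∞). -/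
open Matrix

lemma barrier (f f' : ℝ → ℝ) (hf : ∀ t ≥ (0:ℝ), HasDerivWithinAt f (f' t) (Set.Ici 0) t)
    (K : ℝ) (h : ∀ t ≥ (0:ℝ), K < f t → f' t ≤ 0) : ∀ t ≥ (0:ℝ), f t ≤ max K (f 0) := by
  intro t ht
  have key : ∀ ε > 0, f t ≤ max K (f 0) + ε * (1 + t) := by
    intro ε hε
    refine image_le_of_deriv_right_lt_deriv_boundary (f := f) (f' := f') (a := 0) (b := t)
      (B := fun t => max K (f 0) + ε * (1 + t)) (B' := fun _ => ε) ?_ ?_ ?_ ?_ ?_ ⟨ht, le_rfl⟩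
    · intro x hx
      exact ((hf x hx.1).continuousWithinAt).mono (fun y hy => hy.1)
    · intro x hx
      exact (hf x hx.1).mono (fun y hy => le_trans hx.1 hy)
    · have := le_max_right K (f 0)
      linarith
    · intro x
      have := ((hasDerivAt_id x).const_add 1).const_mul ε |>.const_add (max K (f 0))
      simpa using this
    · intro x hx he
      have h1 := le_max_left K (f 0)
      have : 0 < ε * (1 + x) := by have := hx.1; positivity
      have := h x hx.1 (by rw [he]; linarith)
      linarith
  by_contra hc
  push Not at hc
  have := key ((f t - max K (f 0)) / (2 * (1 + t))) (by apply div_pos <;> linarith)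
  have e : (f t - max K (f 0)) / (2 * (1 + t)) * (1 + t) = (f t - max K (f 0)) / 2 := by
    field_simp
  rw [e] at this
  linarith

/-- bounded on the half line -/
def Bd (f : ℝ → ℝ) : Prop := ∃ M, ∀ t ≥ (0:ℝ), |f t| ≤ M

lemma Bd.add {f g : ℝ → ℝ} (hf : Bd f) (hg : Bd g) : Bd (fun t => f t + g t) := by
  obtain ⟨M, hM⟩ := hf
  obtain ⟨N, hN⟩ := hg
  exact ⟨M + N, fun t ht => (abs_add_le _ _).trans (add_le_add (hM t ht) (hN t ht))⟩

lemma Bd.const (c : ℝ) : Bd (fun _ => c) := ⟨|c|, fun _ _ => le_rfl⟩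

lemma Bd.cmul {f : ℝ → ℝ} (c : ℝ) (hf : Bd f) : Bd (fun t => c * f t) := by
  obtain ⟨M, hM⟩ := hf
  refine ⟨|c| * M, fun t ht => ?_⟩
  rw [abs_mul]
  exact mul_le_mul_of_nonneg_left (hM t ht) (abs_nonneg _)

lemma Bd.sub {f g : ℝ → ℝ} (hf : Bd f) (hg : Bd g) : Bd (fun t => f t - g t) := by
  have := hf.add (hg.cmul (-1))
  refine (funext fun t => ?_ : (fun t => f t - g t) = fun t => f t + -1 * g t) ▸ this
  ring

lemma Bd.sum {ι : Type*} (s : Finset ι) {f : ι → ℝ → ℝ} (hf : ∀ i, Bd (f i)) :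
    Bd (fun t => ∑ i ∈ s, f i t) := by
  classical
  induction s using Finset.induction_on with
  | empty => simpa using Bd.const 0
  | insert a s ha ih => simpa [Finset.sum_insert ha] using (hf a).add ih

lemma Bd.mulVec {m n : ℕ} (A : Matrix (Fin m) (Fin n) ℝ) {x : ℝ → Fin n → ℝ}
    (hx : ∀ i, Bd (fun t => x t i)) (j : Fin m) : Bd (fun t => (A *ᵥ x t) j) := by
  simp only [Matrix.mulVec, dotProduct]
  exact Bd.sum _ fun i => (hx i).cmul _

lemma Bd.norm {n : ℕ} {x : ℝ → Fin n → ℝ} (hx : ∀ i, Bd (fun t => x t i)) :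
    ∃ M, ∀ t ≥ (0:ℝ), ‖x t‖ ≤ M := by
  choose M hM using hx
  refine ⟨∑ i, |M i|, fun t ht => ?_⟩
  rw [pi_norm_le_iff_of_nonneg (Finset.sum_nonneg fun i _ => abs_nonneg _)]
  intro i
  exact ((hM i t ht).trans (le_abs_self _)).trans
    (Finset.single_le_sum (f := fun i => |M i|) (fun i _ => abs_nonneg _) (Finset.mem_univ i))

lemma Bd.barrier {f f' : ℝ → ℝ} (hf : ∀ t ≥ (0:ℝ), HasDerivWithinAt f (f' t) (Set.Ici 0) t)
    (K K' : ℝ) (h : ∀ t ≥ (0:ℝ), K < f t → f' t ≤ 0) (h' : ∀ t ≥ (0:ℝ), f t < K' → 0 ≤ f' t) :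
    Bd f := by
  refine ⟨max (max K (f 0)) (max (-K') (-f 0)), fun t ht => abs_le'.2 ⟨?_, ?_⟩⟩
  · exact (_root_.barrier f f' hf K h t ht).trans (le_max_left _ _)
  · have := _root_.barrier (fun t => - f t) (fun t => - f' t) (fun t ht => (hf t ht).fun_neg) (-K')
      (fun t ht hh => by have := h' t ht (by linarith); linarith) t ht
    exact this.trans (le_max_right _ _)

lemma matBound {m n : ℕ} (A : Matrix (Fin m) (Fin n) ℝ) :
    ∃ α > 0, ∀ x, (A *ᵥ x) ⬝ᵥ (A *ᵥ x) ≤ α * (x ⬝ᵥ x) := by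
  refine ⟨(∑ i, ∑ j, A i j ^ 2) + 1, by positivity, fun x => ?_⟩
  have h0 : 0 ≤ x ⬝ᵥ x := by
    simp only [dotProduct]; exact Finset.sum_nonneg fun i _ => mul_self_nonneg _
  have : (A *ᵥ x) ⬝ᵥ (A *ᵥ x) ≤ (∑ i, ∑ j, A i j ^ 2) * (x ⬝ᵥ x) := by
    rw [Finset.sum_mul]
    simp only [dotProduct, Matrix.mulVec]
    refine Finset.sum_le_sum fun i _ => ?_
    have := Finset.sum_mul_sq_le_sq_mul_sq Finset.univ (fun j => A i j) x
    simpa [pow_two] using this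
  linarith

lemma dot_nonneg {n : ℕ} (x : Fin n → ℝ) : 0 ≤ x ⬝ᵥ x := by
  simp only [dotProduct]; exact Finset.sum_nonneg fun i _ => mul_self_nonneg _

/-- the mean-removal matrix -/
noncomputable def Jm (n : ℕ) : Matrix (Fin n) (Fin n) ℝ :=
  1 - (1 / (n:ℝ)) • Matrix.of (fun _ _ => (1:ℝ))

lemma Jm_mulVec {n : ℕ} (x : Fin n → ℝ) (i) : (Jm n *ᵥ x) i = x i - (1 / (n:ℝ)) * ∑ j, x j := by
  rw [Jm, Matrix.sub_mulVec, Matrix.smul_mulVec, Matrix.one_mulVec]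
  simp [Matrix.mulVec, dotProduct]

lemma pinv {n m : ℕ} (hn : 0 < n) (A : Matrix (Fin n) (Fin m) ℝ)
    (h1 : Aᵀ *ᵥ (fun _ => 1) = 0)
    (hker : ∀ x, Aᵀ *ᵥ x = 0 → ∃ c : ℝ, x = fun _ => c) :
    ∃ N : Matrix (Fin n) (Fin n) ℝ, N * (A * Aᵀ) = Jm n ∧ (A * Aᵀ) * N = Jm n := by
  have hn' : (n:ℝ) ≠ 0 := by positivity
  set U : Matrix (Fin n) (Fin n) ℝ := Matrix.of (fun _ _ => (1:ℝ)) with hU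
  have hUt : Uᵀ = U := by ext; simp [hU]
  have hAU : Aᵀ * U = 0 := by
    ext i j
    have := congrFun h1 i
    simpa [Matrix.mul_apply, Matrix.mulVec, dotProduct, hU] using this
  have hUA : U * A = 0 := by
    have := congrArg Matrix.transpose hAU
    simpa [Matrix.transpose_mul, hUt] using this
  have hUU : U * U = (n:ℝ) • U := by
    ext i j; simp [hU, Matrix.mul_apply]
  set M := A * Aᵀ + U with hM
  have hMU : M * U = (n:ℝ) • U := by
    rw [hM, add_mul, Matrix.mul_assoc, hAU, hUU]; simp
  have hUM : U * M = (n:ℝ) • U := by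
    rw [hM, mul_add, ← Matrix.mul_assoc, hUA, hUU]; simp
  have hinj : Function.Injective M.mulVec := by
    rw [← Matrix.coe_mulVecLin, ← LinearMap.ker_eq_bot, LinearMap.ker_eq_bot']
    intro x hx
    have hx : M *ᵥ x = 0 := by simpa using hx
    have e : x ⬝ᵥ (M *ᵥ x) = (Aᵀ *ᵥ x) ⬝ᵥ (Aᵀ *ᵥ x) + (∑ i, x i) ^ 2 := by
      rw [hM, Matrix.add_mulVec, dotProduct_add, ← Matrix.mulVec_mulVec, Matrix.dotProduct_mulVec,
        ← Matrix.mulVec_transpose]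
      congr 1
      simp [hU, Matrix.mulVec, dotProduct, ← Finset.sum_mul, pow_two]
    rw [hx, dotProduct_zero] at e
    have p1 := dot_nonneg (Aᵀ *ᵥ x)
    have p2 := sq_nonneg (∑ i, x i)
    have e1 : (Aᵀ *ᵥ x) ⬝ᵥ (Aᵀ *ᵥ x) = 0 := by linarith
    have e2 : (∑ i, x i) ^ 2 = 0 := by linarith
    obtain ⟨c, rfl⟩ := hker x (dotProduct_self_eq_zero.1 e1)
    have : c = 0 := by simpa [hn.ne'] using e2
    subst this
    rfl
  have hu : IsUnit M := Matrix.mulVec_injective_iff_isUnit.1 hinj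
  have hd : IsUnit M.det := (Matrix.isUnit_iff_isUnit_det _).1 hu
  have i1 : M⁻¹ * M = 1 := Matrix.nonsing_inv_mul _ hd
  have i2 : M * M⁻¹ = 1 := Matrix.mul_nonsing_inv _ hd
  have n1 : M⁻¹ * U = (1 / (n:ℝ)) • U := by
    have := congrArg (fun Z => (1 / (n:ℝ)) • (M⁻¹ * Z)) hMU
    simp only [← Matrix.mul_assoc, i1, Matrix.one_mul, Matrix.mul_smul, smul_smul] at this
    rw [this]; simp [hn']
  have n2 : U * M⁻¹ = (1 / (n:ℝ)) • U := by
    have := congrArg (fun Z => (1 / (n:ℝ)) • (Z * M⁻¹)) hUM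
    simp only [Matrix.mul_assoc, i2, Matrix.mul_one, Matrix.smul_mul, smul_smul] at this
    rw [this]; simp [hn']
  have hK : A * Aᵀ = M - U := by rw [hM]; simp
  refine ⟨M⁻¹, ?_, ?_⟩
  · rw [hK, mul_sub, i1, n1]; rfl
  · rw [hK, sub_mul, i2, n2]; rfl

lemma hasDeriv_dot {n : ℕ} {x y xd yd : ℝ → Fin n → ℝ} {t : ℝ} {s : Set ℝ}
    (hx : HasDerivWithinAt x (xd t) s t) (hy : HasDerivWithinAt y (yd t) s t) :
    HasDerivWithinAt (fun t => x t ⬝ᵥ y t) (xd t ⬝ᵥ y t + x t ⬝ᵥ yd t) s t := by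
  have hx' := hasDerivWithinAt_pi.1 hx
  have hy' := hasDerivWithinAt_pi.1 hy
  have := HasDerivWithinAt.fun_sum (u := Finset.univ) (fun i _ => (hx' i).fun_mul (hy' i))
  simpa [dotProduct, Finset.sum_add_distrib] using this

lemma hasDeriv_mulVec {n m : ℕ} (A : Matrix (Fin m) (Fin n) ℝ) {x : ℝ → Fin n → ℝ}
    {xd : Fin n → ℝ} {t : ℝ} {s : Set ℝ} (hx : HasDerivWithinAt x xd s t) :
    HasDerivWithinAt (fun t => A *ᵥ x t) (A *ᵥ xd) s t := by
  have hx' := hasDerivWithinAt_pi.1 hx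
  rw [hasDerivWithinAt_pi]
  intro i
  simp only [Matrix.mulVec, dotProduct]
  exact HasDerivWithinAt.fun_sum (u := Finset.univ) (fun j _ => (hx' j).const_mul _)

lemma prox_first {f : ℝ → ℝ} (hf : ConvexOn ℝ Set.univ f) {x y : ℝ}
    (h : IsMinOn (fun x : ℝ => f x + (1 / 2) * (x - y) ^ 2) Set.univ x) (z : ℝ) :
    (y - x) * (z - x) ≤ f z - f x := by
  by_contra hc
  push Not at hc
  set g := (y - x) * (z - x) - (f z - f x) with hg
  have hgp : 0 < g := by linarith
  set q := (z - x) ^ 2 with hq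
  have hq0 : 0 ≤ q := sq_nonneg _
  set τ := g / (g + q + 1) with hτ
  have t0 : 0 < τ := by positivity
  have t1 : τ ≤ 1 := by rw [hτ, div_le_one (by positivity)]; linarith
  have te : τ * (g + q + 1) = g := by rw [hτ]; field_simp
  have c := hf.2 (Set.mem_univ x) (Set.mem_univ z) (sub_nonneg.2 t1) t0.le (by ring)
  have m := h (Set.mem_univ ((1 - τ) • x + τ • z))
  simp only [smul_eq_mul, Set.mem_ofPred_eq] at c m
  have : τ * g ≤ τ * (τ * q / 2) := by
    rw [hq, hg]; nlinarith
  have := le_of_mul_le_mul_left this t0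
  nlinarith [mul_pos t0 hgp]

lemma Bd.mul {f g : ℝ → ℝ} (hf : Bd f) (hg : Bd g) : Bd (fun t => f t * g t) := by
  obtain ⟨M, hM⟩ := hf
  obtain ⟨N, hN⟩ := hg
  refine ⟨M * N, fun t ht => ?_⟩
  rw [abs_mul]
  exact mul_le_mul (hM t ht) (hN t ht) (abs_nonneg _) ((abs_nonneg _).trans (hM t ht))

lemma Bd.of_dot {n : ℕ} {x : ℝ → Fin n → ℝ} {M : ℝ} (h : ∀ t ≥ (0:ℝ), x t ⬝ᵥ x t ≤ M) (i : Fin n) :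
    Bd (fun t => x t i) := by
  refine ⟨M + 1, fun t ht => ?_⟩
  have h1 : x t i * x t i ≤ x t ⬝ᵥ x t :=
    Finset.single_le_sum (f := fun i => x t i * x t i) (fun i _ => mul_self_nonneg _)
      (Finset.mem_univ i)
  have := h t ht
  rw [abs_le']
  constructor <;> nlinarith [sq_nonneg (x t i - 1), sq_nonneg (x t i + 1)]

lemma osc {n m : ℕ} (hn : 0 < n) (A : Matrix (Fin n) (Fin m) ℝ)
    (h1 : Aᵀ *ᵥ (fun _ => 1) = 0)
    (hker : ∀ x, Aᵀ *ᵥ x = 0 → ∃ c : ℝ, x = fun _ => c)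
    (G : Matrix (Fin n) (Fin n) ℝ) (g : ℝ) (hg : 0 < g)
    (w v wd : ℝ → Fin n → ℝ) (Q Qd : ℝ → Fin m → ℝ)
    (hw : ∀ t ≥ (0:ℝ), HasDerivWithinAt w (wd t) (Set.Ici 0) t)
    (hQ : ∀ t ≥ (0:ℝ), HasDerivWithinAt Q (Qd t) (Set.Ici 0) t)
    (hwd : ∀ t ≥ (0:ℝ), wd t = (1 / 2 : ℝ) • (v t - G *ᵥ w t - A *ᵥ Q t))
    (hQd : ∀ t ≥ (0:ℝ), Qd t = Aᵀ *ᵥ w t)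
    (hG : ∀ t ≥ (0:ℝ), g * (w t ⬝ᵥ w t) ≤ w t ⬝ᵥ (G *ᵥ w t))
    (hv : ∀ i, Bd (fun t => v t i)) :
    (∀ i, Bd (fun t => w t i)) ∧ (∀ i, Bd (fun t => Q t i)) := by
  obtain ⟨N, hN1, hN2⟩ := pinv hn A h1 hker
  have hAJ : Aᵀ * Jm n = Aᵀ := by
    rw [Jm, Matrix.mul_sub, Matrix.mul_smul]
    have : Aᵀ * (Matrix.of (fun _ _ => (1:ℝ)) : Matrix (Fin n) (Fin n) ℝ) = (0 : Matrix (Fin m) (Fin n) ℝ) := by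
      ext i j
      have := congrFun h1 i
      simpa [Matrix.mul_apply, Matrix.mulVec, dotProduct] using this
    rw [this]; simp
  have hJt : (Jm n)ᵀ = Jm n := by
    rw [Jm, Matrix.transpose_sub, Matrix.transpose_smul, Matrix.transpose_one]; rfl
  have hJA : Jm n * A = A := by
    have := congrArg Matrix.transpose hAJ
    simpa [Matrix.transpose_mul, hJt] using this
  set S := Aᵀ * N with hS
  have hS1 : S * A * Aᵀ = Aᵀ := by
    rw [hS, Matrix.mul_assoc, Matrix.mul_assoc, hN1, hAJ]
  have hS2 : A * (S * A) = A := by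
    rw [hS, ← Matrix.mul_assoc, ← Matrix.mul_assoc, hN2, hJA]
  set Z : ℝ → Fin m → ℝ := fun t => (S * A) *ᵥ Q t with hZ
  have hAZ : ∀ t, A *ᵥ Z t = A *ᵥ Q t := fun t => by
    simp only [hZ, Matrix.mulVec_mulVec, hS2]
  have hZS : ∀ t, Z t = S *ᵥ (A *ᵥ Z t) := fun t => by
    rw [hAZ]; simp only [hZ, Matrix.mulVec_mulVec]
  have hZd : ∀ t ≥ (0:ℝ), HasDerivWithinAt Z (Aᵀ *ᵥ w t) (Set.Ici 0) t := by
    intro t ht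
    have := hasDeriv_mulVec (S * A) (hQ t ht)
    rw [hQd t ht, Matrix.mulVec_mulVec, hS1] at this
    exact this
  obtain ⟨c, hc, hcb⟩ := matBound S
  obtain ⟨α, hα, hαb⟩ := matBound A
  obtain ⟨α', hα', hαb'⟩ := matBound Aᵀ
  obtain ⟨γ, hγ, hγb⟩ := matBound G
  obtain ⟨Kv, hKv⟩ : Bd (fun t => v t ⬝ᵥ v t) := by
    simp only [dotProduct]
    exact Bd.sum _ fun i => (hv i).mul (hv i)
  obtain ⟨ε, hε, hε1, hε2, hε3⟩ : ∃ ε > 0, ε ≤ 1 ∧ ε * α ≤ 1 / 2 ∧ ε * (γ / 2 + α') ≤ g / 4 := by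
    refine ⟨min 1 (min (1 / 2 / α) (g / 4 / (γ / 2 + α'))), by positivity, min_le_left _ _, ?_, ?_⟩
    · rw [← le_div_iff₀ hα]; exact (min_le_right _ _).trans (min_le_left _ _)
    · rw [← le_div_iff₀ (by positivity)]; exact (min_le_right _ _).trans (min_le_right _ _)
  obtain ⟨δ, hδ, hδ1, hδ2⟩ : ∃ δ > 0, δ * (1 + ε / 2) ≤ g / 2 ∧ δ * (c / 2 + ε / 2) ≤ ε / 4 := by
    refine ⟨min (g / 2 / (1 + ε / 2)) (ε / 4 / (c / 2 + ε / 2)), by positivity, ?_, ?_⟩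
    · rw [← le_div_iff₀ (by positivity)]; exact min_le_left _ _
    · rw [← le_div_iff₀ (by positivity)]; exact min_le_right _ _
  set V : ℝ → ℝ := fun t => w t ⬝ᵥ w t + (1 / 2) * (Z t ⬝ᵥ Z t) + ε * (w t ⬝ᵥ (A *ᵥ Z t)) with hV
  set Vd : ℝ → ℝ := fun t => (wd t ⬝ᵥ w t + w t ⬝ᵥ wd t)
    + (1 / 2) * ((Aᵀ *ᵥ w t) ⬝ᵥ Z t + Z t ⬝ᵥ (Aᵀ *ᵥ w t))
    + ε * (wd t ⬝ᵥ (A *ᵥ Z t) + w t ⬝ᵥ (A *ᵥ (Aᵀ *ᵥ w t))) with hVd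
  have hVD : ∀ t ≥ (0:ℝ), HasDerivWithinAt V (Vd t) (Set.Ici 0) t := by
    intro t ht
    have d1 := hasDeriv_dot (hw t ht) (hw t ht)
    have d2 := (hasDeriv_dot (xd := fun t => Aᵀ *ᵥ w t) (yd := fun t => Aᵀ *ᵥ w t)
      (hZd t ht) (hZd t ht)).const_mul (1 / 2 : ℝ)
    have d3 := (hasDeriv_dot (yd := fun t => A *ᵥ (Aᵀ *ᵥ w t)) (hw t ht)
      (hasDeriv_mulVec A (hZd t ht))).const_mul ε
    exact (d1.fun_add d2).fun_add d3
  have hcross : ∀ t, 2 * (w t ⬝ᵥ (A *ᵥ Z t)) ≤ w t ⬝ᵥ w t + (A *ᵥ Z t) ⬝ᵥ (A *ᵥ Z t) ∧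
      -(2 * (w t ⬝ᵥ (A *ᵥ Z t))) ≤ w t ⬝ᵥ w t + (A *ᵥ Z t) ⬝ᵥ (A *ᵥ Z t) := by
    intro t
    have e1 := dot_nonneg (w t - A *ᵥ Z t)
    have e2 := dot_nonneg (w t + A *ᵥ Z t)
    simp only [sub_dotProduct, dotProduct_sub, add_dotProduct, dotProduct_add,
      dotProduct_comm (A *ᵥ Z t) (w t)] at e1 e2
    constructor <;> linarith
  have hdiss : ∀ t ≥ (0:ℝ), Vd t ≤ -(g / 2) * (w t ⬝ᵥ w t)
      - ε / 4 * ((A *ᵥ Z t) ⬝ᵥ (A *ᵥ Z t)) + (1 / g + ε / 2) * Kv := by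
    intro t ht
    have i1 : (Aᵀ *ᵥ w t) ⬝ᵥ Z t = w t ⬝ᵥ (A *ᵥ Z t) := by
      rw [Matrix.dotProduct_mulVec (w t) A (Z t), Matrix.mulVec_transpose]
    have i2 : w t ⬝ᵥ (A *ᵥ (Aᵀ *ᵥ w t)) = (Aᵀ *ᵥ w t) ⬝ᵥ (Aᵀ *ᵥ w t) := by
      rw [Matrix.dotProduct_mulVec, Matrix.mulVec_transpose]
    have e1 := dot_nonneg ((g / 2) • w t - v t)
    have e2 := dot_nonneg ((1 / 2 : ℝ) • (A *ᵥ Z t) - v t)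
    have e3 := dot_nonneg ((1 / 2 : ℝ) • (A *ᵥ Z t) + G *ᵥ w t)
    have hk := (le_abs_self _).trans (hKv t ht)
    have hGt := hG t ht
    have b1 := hγb (w t)
    have b2 := hαb' (w t)
    have a0 := dot_nonneg (w t)
    simp only [hVd]
    rw [hwd t ht, i2, dotProduct_comm (Z t), i1, ← hAZ t]
    generalize A *ᵥ Z t = R at *
    generalize G *ᵥ w t = H at *
    generalize (Aᵀ *ᵥ w t) ⬝ᵥ (Aᵀ *ᵥ w t) = AA at *
    simp only [sub_dotProduct, dotProduct_sub, add_dotProduct, dotProduct_add, smul_dotProduct,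
      dotProduct_smul, smul_eq_mul, dotProduct_comm (v t) (w t), dotProduct_comm H (w t),
      dotProduct_comm R (w t), dotProduct_comm R (v t), dotProduct_comm R H] at *
    generalize w t ⬝ᵥ w t = a at *
    generalize w t ⬝ᵥ v t = wv at *
    generalize w t ⬝ᵥ H = wH at *
    generalize w t ⬝ᵥ R = wR at *
    generalize v t ⬝ᵥ v t = vv at *
    generalize v t ⬝ᵥ R = vR at *
    generalize H ⬝ᵥ R = HR at *
    generalize H ⬝ᵥ H = HH at *
    generalize R ⬝ᵥ R = b at *
    have f1 : wv ≤ g / 4 * a + 1 / g * vv := by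
      have : 0 ≤ 1 / g * (g / 2 * (g / 2 * a) - g / 2 * wv - (g / 2 * wv - vv)) := by
        apply mul_nonneg (by positivity); linarith
      have e : 1 / g * (g / 2 * (g / 2 * a) - g / 2 * wv - (g / 2 * wv - vv))
        = g / 4 * a - wv + 1 / g * vv := by field_simp; ring
      linarith
    have f2 : 1 / g * vv ≤ 1 / g * Kv := mul_le_mul_of_nonneg_left hk (by positivity)
    have f3 : ε * (1 / 2 * (vR - HR - b) + AA) ≤ ε * (-(1 / 4) * b + 1 / 2 * Kv + (γ / 2 + α') * a) :=
      mul_le_mul_of_nonneg_left (by linarith) hε.le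
    have f4 : ε * (γ / 2 + α') * a ≤ g / 4 * a := mul_le_mul_of_nonneg_right hε3 a0
    linarith
  have hVle : ∀ t, V t ≤ (1 + ε / 2) * (w t ⬝ᵥ w t)
      + (c / 2 + ε / 2) * ((A *ᵥ Z t) ⬝ᵥ (A *ᵥ Z t)) := by
    intro t
    have := mul_le_mul_of_nonneg_left (hcross t).1 hε.le
    have h2 := hcb (A *ᵥ Z t)
    rw [← hZS t] at h2
    simp only [hV]
    linarith
  have hVge : ∀ t, 1 / 2 * (w t ⬝ᵥ w t) + 1 / 4 * (Z t ⬝ᵥ Z t) ≤ V t := by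
    intro t
    have h1 := mul_le_mul_of_nonneg_left (hcross t).2 hε.le
    have h2 := mul_le_mul_of_nonneg_left (hαb (Z t)) hε.le
    have h3 := mul_le_mul_of_nonneg_right hε2 (dot_nonneg (Z t))
    have h4 := mul_le_mul_of_nonneg_right hε1 (dot_nonneg (w t))
    simp only [hV]
    linarith
  have hVb := barrier V Vd hVD ((1 / g + ε / 2) * Kv / δ) (by
    intro t ht hlt
    rw [div_lt_iff₀ hδ] at hlt
    have h1 := hdiss t ht
    have h2 := mul_le_mul_of_nonneg_left (hVle t) hδ.le
    have h3 := mul_le_mul_of_nonneg_right hδ1 (dot_nonneg (w t))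
    have h4 := mul_le_mul_of_nonneg_right hδ2 (dot_nonneg (A *ᵥ Z t))
    linarith)
  set VM := max ((1 / g + ε / 2) * Kv / δ) (V 0)
  have hwB : ∀ i, Bd (fun t => w t i) := Bd.of_dot (M := 2 * VM) (fun t ht => by
    have := hVge t; have := hVb t ht; have := dot_nonneg (Z t); linarith)
  have hZB : ∀ i, Bd (fun t => Z t i) := Bd.of_dot (M := 4 * VM) (fun t ht => by
    have := hVge t; have := hVb t ht; have := dot_nonneg (w t); linarith)
  refine ⟨hwB, fun i => ?_⟩
  have hdiff : Bd (fun t => Q t i - Z t i) := by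
    refine Bd.barrier (f' := fun _ => 0) (fun t ht => ?_) 0 0 (fun _ _ _ => le_rfl)
      (fun _ _ _ => le_rfl)
    have := (hasDerivWithinAt_pi.1 (hQ t ht) i).fun_sub (hasDerivWithinAt_pi.1 (hZd t ht) i)
    rw [hQd t ht, sub_self] at this
    exact this
  have := hdiff.add (hZB i)
  simpa using this

/-- Any continuously differentiable trajectory of the DPPD dynamics without
line-limit constraints, starting with `d(0) ∈ Ω`, is bounded on `[0, ∞)`, provided an
interior point `d̃` of `Ω` and `θ̃` with `P^in − d̃ − C B Cᵀ θ̃ = 0` exist. -/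
theorem dppd_trajectory_bounded
    {n l : ℕ} (hn : 0 < n) (hl : 0 < l)
    (C : Matrix (Fin n) (Fin l) ℝ)
    (hC1 : Matrix.vecMul (fun _ => (1:ℝ)) C = 0)
    (hker : ∀ x : Fin n → ℝ, Cᵀ.mulVec x = 0 ↔ ∃ c : ℝ, x = fun _ => c)
    (B : Matrix (Fin l) (Fin l) ℝ)
    (hBdiag : ∀ e f, e ≠ f → B e f = 0) (hBpos : ∀ e, 0 < B e e)
    (D : Matrix (Fin n) (Fin n) ℝ)
    (hDdiag : ∀ i j, i ≠ j → D i j = 0) (hDpos : ∀ i, 0 < D i i)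
    (Pin : Fin n → ℝ)
    (dlo dhi : Fin n → ℝ) (hbox : ∀ i, dlo i ≤ dhi i)
    (f0 : Fin n → ℝ → ℝ) (hf0diff : ∀ i, Differentiable ℝ (f0 i))
    (β : ℝ) (hβ : 1 < β)
    (hf0sc : ∀ (i : Fin n) (x y : ℝ),
      f0 i x + deriv (f0 i) x * (y - x) + β / 2 * (y - x) ^ 2 ≤ f0 i y)
    (f2 : Fin n → ℝ → ℝ) (hf2conv : ∀ i, ConvexOn ℝ Set.univ (f2 i))
    (κ : ℝ) (hκ : κ ∈ Set.Ioo (0:ℝ) 1)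
    -- the trajectory and its derivatives
    (η d ω μ θh : ℝ → Fin n → ℝ) (P : ℝ → Fin l → ℝ)
    (ηd dd ωd μd θhd : ℝ → Fin n → ℝ) (Pd : ℝ → Fin l → ℝ)
    (hηD : ∀ t ≥ (0:ℝ), HasDerivWithinAt η (ηd t) (Set.Ici 0) t)
    (hdD : ∀ t ≥ (0:ℝ), HasDerivWithinAt d (dd t) (Set.Ici 0) t)
    (hωD : ∀ t ≥ (0:ℝ), HasDerivWithinAt ω (ωd t) (Set.Ici 0) t)
    (hμD : ∀ t ≥ (0:ℝ), HasDerivWithinAt μ (μd t) (Set.Ici 0) t)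
    (hθD : ∀ t ≥ (0:ℝ), HasDerivWithinAt θh (θhd t) (Set.Ici 0) t)
    (hPD : ∀ t ≥ (0:ℝ), HasDerivWithinAt P (Pd t) (Set.Ici 0) t)
    (hηC : ContinuousOn ηd (Set.Ici 0)) (hdC : ContinuousOn dd (Set.Ici 0))
    (hωC : ContinuousOn ωd (Set.Ici 0)) (hμC : ContinuousOn μd (Set.Ici 0))
    (hθC : ContinuousOn θhd (Set.Ici 0)) (hPC : ContinuousOn Pd (Set.Ici 0))
    -- DPPD dynamics (without line limits), with
    -- u₁ = P^in − d − Dω − CP and u₂ = P^in − d − C B Cᵀ θ̂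
    (hdynη : ∀ t ≥ (0:ℝ), ∀ i, IsMinOn
      (fun x : ℝ => f2 i x + (1 / 2) * (x - (d t i - κ * η t i)) ^ 2) Set.univ
      (ηd t i + d t i))
    (hdynd : ∀ t ≥ (0:ℝ), ∀ i, dd t i =
      max (dlo i) (min (dhi i)
        (d t i - deriv (f0 i) (d t i) + κ * η t i + ω t i
          + (Pin - d t - D.mulVec (ω t) - C.mulVec (P t)) i + μ t i
          + (Pin - d t - (C * B * Cᵀ).mulVec (θh t)) i)) - d t i)
    (hdynθ : ∀ t ≥ (0:ℝ),
      θhd t = (C * B * Cᵀ).mulVec (μ t + (Pin - d t - (C * B * Cᵀ).mulVec (θh t))))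
    (hdynP : ∀ t ≥ (0:ℝ),
      Pd t = Cᵀ.mulVec (ω t + (Pin - d t - D.mulVec (ω t) - C.mulVec (P t))))
    (hdynω : ∀ t ≥ (0:ℝ),
      ωd t = (1 / 2 : ℝ) • (Pin - d t - D.mulVec (ω t) - C.mulVec (P t)))
    (hdynμ : ∀ t ≥ (0:ℝ),
      μd t = (1 / 2 : ℝ) • (Pin - d t - (C * B * Cᵀ).mulVec (θh t)))
    -- initial feasibility
    (hd0 : ∀ i, d 0 i ∈ Set.Icc (dlo i) (dhi i))
    -- existence of an interior feasible load profile
    (hfeasible : ∃ (dt θt : Fin n → ℝ),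
      (∀ i, dlo i < dt i ∧ dt i < dhi i) ∧ Pin - dt - (C * B * Cᵀ).mulVec θt = 0) :
    ∃ M : ℝ, ∀ t ≥ (0:ℝ),
      ‖η t‖ ≤ M ∧ ‖d t‖ ≤ M ∧ ‖θh t‖ ≤ M ∧ ‖P t‖ ≤ M ∧ ‖ω t‖ ≤ M ∧ ‖μ t‖ ≤ M := by
  obtain ⟨dt, θt, hdt, hθt⟩ := hfeasible
  obtain ⟨hκ0, hκ1⟩ := hκ
  have hnR : (0:ℝ) < n := by exact_mod_cast hn
  set L := C * B * Cᵀ with hL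
  have hC1' : Cᵀ *ᵥ (fun _ => (1:ℝ)) = 0 := by rw [Matrix.mulVec_transpose]; exact hC1
  -- componentwise derivatives
  have dη := fun t ht => hasDerivWithinAt_pi.1 (hηD t ht)
  have ddd := fun t ht => hasDerivWithinAt_pi.1 (hdD t ht)
  -- `d` stays in the box
  have hdhi : ∀ i, ∀ t ≥ (0:ℝ), d t i ≤ dhi i := by
    intro i t ht
    have := barrier (fun t => d t i) (fun t => dd t i) (fun t ht => ddd t ht i) (dhi i) (by
      intro t ht hlt
      rw [hdynd t ht i]
      have : ∀ z, max (dlo i) (min (dhi i) z) ≤ dhi i := fun z => max_le (hbox i) (min_le_left _ _)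
      linarith [this (d t i - deriv (f0 i) (d t i) + κ * η t i + ω t i
          + (Pin - d t - D.mulVec (ω t) - C.mulVec (P t)) i + μ t i
          + (Pin - d t - L.mulVec (θh t)) i)]) t ht
    exact this.trans (max_le le_rfl (hd0 i).2)
  have hdlo : ∀ i, ∀ t ≥ (0:ℝ), dlo i ≤ d t i := by
    intro i t ht
    have := barrier (fun t => - d t i) (fun t => - dd t i) (fun t ht => (ddd t ht i).fun_neg)
      (- dlo i) (by
      intro t ht hlt
      rw [hdynd t ht i]
      have : ∀ z, dlo i ≤ max (dlo i) (min (dhi i) z) := fun z => le_max_left _ _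
      linarith [this (d t i - deriv (f0 i) (d t i) + κ * η t i + ω t i
          + (Pin - d t - D.mulVec (ω t) - C.mulVec (P t)) i + μ t i
          + (Pin - d t - L.mulVec (θh t)) i)]) t ht
    have h2 := this.trans (max_le le_rfl (neg_le_neg (hd0 i).1))
    linarith
  have Bdd : ∀ i, Bd (fun t => d t i) := fun i =>
    ⟨max (dhi i) (- dlo i), fun t ht => abs_le'.2 ⟨(hdhi i t ht).trans (le_max_left _ _),
      (neg_le_neg (hdlo i t ht)).trans (le_max_right _ _)⟩⟩
  -- the gradient is bounded along the trajectory
  have hmono : ∀ i x y, x ≤ y → deriv (f0 i) x ≤ deriv (f0 i) y := by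
    intro i x y hxy
    rcases hxy.eq_or_lt with rfl | hlt
    · exact le_rfl
    have h1 := hf0sc i x y
    have h2 := hf0sc i y x
    by_contra hc
    push Not at hc
    nlinarith [mul_pos (sub_pos.2 hc) (sub_pos.2 hlt), sq_nonneg (y - x)]
  have Bdf : ∀ i, Bd (fun t => deriv (f0 i) (d t i)) := fun i =>
    ⟨max (deriv (f0 i) (dhi i)) (- deriv (f0 i) (dlo i)), fun t ht => abs_le'.2
      ⟨(hmono i _ _ (hdhi i t ht)).trans (le_max_left _ _),
      (neg_le_neg (hmono i _ _ (hdlo i t ht))).trans (le_max_right _ _)⟩⟩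
  -- `η` is bounded
  have Bdη : ∀ i, Bd (fun t => η t i) := by
    intro i
    refine Bd.barrier (fun t ht => dη t ht i)
      (-(f2 i (dlo i) - f2 i (dlo i - 1)) / κ) (-(f2 i (dhi i + 1) - f2 i (dhi i)) / κ) ?_ ?_
    · intro t ht hlt
      rw [div_lt_iff₀ hκ0] at hlt
      by_contra hc
      push Not at hc
      have h1 := prox_first (hf2conv i) (hdynη t ht i) (dlo i - 1)
      have hlo := hdlo i t ht
      have hs := (hf2conv i).slope_mono_adjacent (x := dlo i - 1) (y := dlo i)
        (z := ηd t i + d t i) (Set.mem_univ _) (Set.mem_univ _) (by linarith) (by linarith)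
      set x := ηd t i + d t i with hx
      set s := f2 i (dlo i) - f2 i (dlo i - 1) with hs'
      have hxp : 0 < x - dlo i := by linarith
      rw [le_div_iff₀ hxp, sub_sub_cancel, div_one] at hs
      have : s * (x - (dlo i - 1)) ≤ (d t i - κ * η t i - x) * (x - (dlo i - 1)) := by
        nlinarith
      have := le_of_mul_le_mul_right this (by linarith)
      linarith
    · intro t ht hlt
      rw [lt_div_iff₀ hκ0] at hlt
      by_contra hc
      push Not at hc
      have h1 := prox_first (hf2conv i) (hdynη t ht i) (dhi i + 1)
      have hhi := hdhi i t ht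
      have hs := (hf2conv i).slope_mono_adjacent (x := ηd t i + d t i) (y := dhi i)
        (z := dhi i + 1) (Set.mem_univ _) (Set.mem_univ _) (by linarith) (by linarith)
      set x := ηd t i + d t i with hx
      set s := f2 i (dhi i + 1) - f2 i (dhi i) with hs'
      have hxp : 0 < dhi i - x := by linarith
      rw [div_le_iff₀ hxp, add_sub_cancel_left, div_one] at hs
      have : (d t i - κ * η t i - x) * (dhi i + 1 - x) ≤ s * (dhi i + 1 - x) := by
        nlinarith
      have := le_of_mul_le_mul_right this (by linarith)
      linarith
  -- the `(ω, P)` subsystem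
  have hDt : ∀ x i, (D *ᵥ x) i = D i i * x i := by
    intro x i
    simp only [Matrix.mulVec, dotProduct]
    exact Finset.sum_eq_single i (fun j _ hj => by rw [hDdiag i j hj.symm, zero_mul]) (by simp)
  obtain ⟨g, hg, hgD⟩ : ∃ g > 0, ∀ i, g ≤ D i i := by
    have : Nonempty (Fin n) := ⟨⟨0, hn⟩⟩
    obtain ⟨i0, hi0⟩ := Finite.exists_min (fun i => D i i)
    exact ⟨D i0 i0, hDpos i0, hi0⟩
  have Bdv : ∀ i, Bd (fun t => (Pin - d t) i) := fun i => (Bd.const (Pin i)).sub (Bdd i)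
  obtain ⟨Bdω, BdQ⟩ := osc hn C hC1' (fun x hx => (hker x).1 hx) (D + (2:ℝ) • (C * Cᵀ)) g hg
    ω (fun t => Pin - d t) ωd (fun t => P t - (2:ℝ) • (Cᵀ *ᵥ ω t))
    (fun t => Pd t - (2:ℝ) • (Cᵀ *ᵥ ωd t)) hωD
    (fun t ht => (hPD t ht).fun_sub ((hasDeriv_mulVec Cᵀ (hωD t ht)).fun_const_smul 2))
    (by
      intro t ht
      rw [hdynω t ht, Matrix.add_mulVec, Matrix.smul_mulVec, Matrix.mulVec_sub, Matrix.mulVec_smul,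
        Matrix.mulVec_mulVec]
      congr 1
      abel)
    (by
      intro t ht
      simp only [hdynP t ht, hdynω t ht, Matrix.mulVec_add, Matrix.mulVec_smul, smul_smul]
      norm_num)
    (by
      intro t ht
      have e : ω t ⬝ᵥ ((C * Cᵀ) *ᵥ ω t) = (Cᵀ *ᵥ ω t) ⬝ᵥ (Cᵀ *ᵥ ω t) := by
        rw [← Matrix.mulVec_mulVec, Matrix.dotProduct_mulVec, Matrix.mulVec_transpose]
      rw [Matrix.add_mulVec, Matrix.smul_mulVec, dotProduct_add, dotProduct_smul, e, smul_eq_mul]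
      have h1 := dot_nonneg (Cᵀ *ᵥ ω t)
      have h2 : g * (ω t ⬝ᵥ ω t) ≤ ω t ⬝ᵥ (D *ᵥ ω t) := by
        simp only [dotProduct, hDt, Finset.mul_sum]
        refine Finset.sum_le_sum fun i _ => ?_
        nlinarith [mul_le_mul_of_nonneg_right (hgD i) (mul_self_nonneg (ω t i))]
      linarith)
    Bdv
  have BdP : ∀ i, Bd (fun t => P t i) := by
    intro i
    have := (BdQ i).add ((Bd.mulVec Cᵀ Bdω i).cmul 2)
    simpa using this
  -- properties of `L`
  have hBt : Bᵀ = B := by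
    ext e f
    by_cases h : e = f
    · subst h; rfl
    · rw [Matrix.transpose_apply, hBdiag f e (Ne.symm h), hBdiag e f h]
  have hLt : Lᵀ = L := by
    rw [hL, Matrix.transpose_mul, Matrix.transpose_mul, hBt, Matrix.transpose_transpose,
      Matrix.mul_assoc]
  have hL1 : Lᵀ *ᵥ (fun _ => (1:ℝ)) = 0 := by
    rw [hLt, hL, ← Matrix.mulVec_mulVec, hC1', Matrix.mulVec_zero]
  have hLker : ∀ x, Lᵀ *ᵥ x = 0 → ∃ c : ℝ, x = fun _ => c := by
    intro x hx
    rw [hLt] at hx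
    apply (hker x).1
    have e : x ⬝ᵥ (L *ᵥ x) = ∑ e, B e e * (Cᵀ *ᵥ x) e ^ 2 := by
      rw [hL, Matrix.mul_assoc, ← Matrix.mulVec_mulVec, Matrix.dotProduct_mulVec,
        ← Matrix.mulVec_transpose, ← Matrix.mulVec_mulVec]
      simp only [dotProduct]
      refine Finset.sum_congr rfl fun e _ => ?_
      have : (B *ᵥ (Cᵀ *ᵥ x)) e = B e e * (Cᵀ *ᵥ x) e := by
        rw [Matrix.mulVec, dotProduct]
        exact Finset.sum_eq_single e (fun j _ hj => by rw [hBdiag e j hj.symm, zero_mul]) (by simp)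
      rw [this]; ring
    rw [hx, dotProduct_zero] at e
    have := (Finset.sum_eq_zero_iff_of_nonneg
      (fun e _ => mul_nonneg (hBpos e).le (sq_nonneg _))).1 e.symm
    ext e
    have := this e (Finset.mem_univ e)
    simpa [(hBpos e).ne'] using this
  have hsumL : ∀ x, ∑ i, (L *ᵥ x) i = 0 := by
    intro x
    have : (fun _ => (1:ℝ)) ⬝ᵥ (L *ᵥ x) = 0 := by
      rw [Matrix.dotProduct_mulVec, ← Matrix.mulVec_transpose, hL1, zero_dotProduct]
    simpa [dotProduct] using this
  have hLJ : ∀ x, L *ᵥ (Jm n *ᵥ x) = L *ᵥ x := by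
    intro x
    have : Jm n *ᵥ x = x - ((1 / (n:ℝ)) * ∑ j, x j) • (fun _ => (1:ℝ)) := by
      ext i; rw [Jm_mulVec]; simp
    rw [this, Matrix.mulVec_sub, Matrix.mulVec_smul, ← hLt, hL1]; simp
  have hJL : ∀ x, Jm n *ᵥ (L *ᵥ x) = L *ᵥ x := by
    intro x; ext i; rw [Jm_mulVec, hsumL]; simp
  have hJJ : ∀ x, Jm n *ᵥ (Jm n *ᵥ x) = Jm n *ᵥ x := by
    intro x; ext i
    rw [Jm_mulVec]
    simp only [Jm_mulVec, Finset.sum_sub_distrib, Finset.sum_const, Finset.card_univ,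
      Fintype.card_fin, nsmul_eq_mul]
    field_simp
    ring
  obtain ⟨N, hN, -⟩ := pinv hn L hL1 hLker
  obtain ⟨c, hc, hcb⟩ := matBound (N * L)
  -- the `(μ, θ)` subsystem
  obtain ⟨BdJμ, Bdφ⟩ := osc hn L hL1 hLker ((2:ℝ) • (L * L)) (2 / c) (by positivity)
    (fun t => Jm n *ᵥ μ t) (fun t => Jm n *ᵥ (Pin - d t)) (fun t => Jm n *ᵥ μd t)
    (fun t => θh t - (2:ℝ) • (L *ᵥ μ t))
    (fun t => θhd t - (2:ℝ) • (L *ᵥ μd t))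
    (fun t ht => hasDeriv_mulVec _ (hμD t ht))
    (fun t ht => (hθD t ht).fun_sub ((hasDeriv_mulVec L (hμD t ht)).fun_const_smul 2))
    (by
      intro t ht
      simp only [hdynμ t ht, Matrix.mulVec_smul, Matrix.mulVec_sub, Matrix.smul_mulVec,
        ← Matrix.mulVec_mulVec, hLJ, hJL]
      congr 1
      abel)
    (by
      intro t ht
      simp only [hdynθ t ht, hdynμ t ht, Matrix.mulVec_add, Matrix.mulVec_smul, smul_smul, hLt, hLJ]
      norm_num)
    (by
      intro t ht
      have e1 : (Jm n *ᵥ μ t) ⬝ᵥ (((2:ℝ) • (L * L)) *ᵥ (Jm n *ᵥ μ t))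
          = 2 * ((L *ᵥ (Jm n *ᵥ μ t)) ⬝ᵥ (L *ᵥ (Jm n *ᵥ μ t))) := by
        rw [Matrix.smul_mulVec, dotProduct_smul, smul_eq_mul, ← Matrix.mulVec_mulVec,
          Matrix.dotProduct_mulVec, ← Matrix.mulVec_transpose, hLt]
      have e2 := hcb (L *ᵥ (Jm n *ᵥ μ t))
      have e3 : (N * L) *ᵥ (L *ᵥ (Jm n *ᵥ μ t)) = Jm n *ᵥ μ t := by
        rw [Matrix.mulVec_mulVec, Matrix.mul_assoc]
        nth_rewrite 2 [← hLt]
        rw [hN, hJJ]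
      rw [e3] at e2
      rw [e1, div_mul_eq_mul_div, div_le_iff₀ hc]
      linarith)
    (Bd.mulVec _ Bdv)
  -- `u₁` and the θ-part of `u₂` are bounded
  have BdLθ : ∀ i, Bd (fun t => (L *ᵥ θh t) i) := by
    intro i
    have := (Bd.mulVec L Bdφ i).add ((Bd.mulVec L (Bd.mulVec L BdJμ) i).cmul 2)
    refine (funext fun t => ?_ : (fun t => (L *ᵥ θh t) i) = _) ▸ this
    simp only [hLJ, Matrix.mulVec_sub, Matrix.mulVec_smul, Pi.sub_apply, Pi.smul_apply, smul_eq_mul]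
    ring
  have Bdb : ∀ i, Bd (fun t => d t i - deriv (f0 i) (d t i) + κ * η t i + ω t i
      + (Pin i - d t i - (D *ᵥ ω t) i - (C *ᵥ P t) i) + (Jm n *ᵥ μ t) i
      + (Pin i - d t i - (L *ᵥ θh t) i)) := fun i =>
    ((((((Bdd i).sub (Bdf i)).add ((Bdη i).cmul κ)).add (Bdω i)).add
      ((((Bd.const (Pin i)).sub (Bdd i)).sub (Bd.mulVec D Bdω i)).sub (Bd.mulVec C BdP i))).add
      (BdJμ i)).add (((Bd.const (Pin i)).sub (Bdd i)).sub (BdLθ i))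
  -- the mean of `μ`
  have BdS : Bd (fun t => ∑ i, d t i) := Bd.sum _ Bdd
  have hs0 : ∑ i, Pin i = ∑ i, dt i := by
    have : ∑ i, (Pin - dt - L *ᵥ θt) i = 0 := by rw [hθt]; simp
    simp only [Pi.sub_apply, Finset.sum_sub_distrib, hsumL] at this
    linarith
  have hne : (Finset.univ : Finset (Fin n)).Nonempty := ⟨⟨0, hn⟩, Finset.mem_univ _⟩
  have hs1 : ∑ i, Pin i < ∑ i, dhi i := hs0 ▸ Finset.sum_lt_sum_of_nonempty hne fun i _ => (hdt i).2
  have hs2 : ∑ i, dlo i < ∑ i, Pin i := hs0 ▸ Finset.sum_lt_sum_of_nonempty hne fun i _ => (hdt i).1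
  obtain ⟨MS, hMS⟩ := BdS
  choose Mb hMb using Bdb
  set Kb := ∑ i, (|Mb i| + |dhi i| + |dlo i|) with hKb
  have hKbi : ∀ i, |Mb i| + |dhi i| + |dlo i| ≤ Kb := fun i =>
    Finset.single_le_sum (f := fun i => |Mb i| + |dhi i| + |dlo i|)
      (fun i _ => by positivity) (Finset.mem_univ i)
  have hWd : ∀ t ≥ (0:ℝ), HasDerivWithinAt (fun t => ∑ i, μ t i - (1 / 2) * ∑ i, d t i)
      (∑ i, μd t i - (1 / 2) * ∑ i, dd t i) (Set.Ici 0) t := by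
    intro t ht
    exact (HasDerivWithinAt.fun_sum fun i _ => hasDerivWithinAt_pi.1 (hμD t ht) i).fun_sub
      ((HasDerivWithinAt.fun_sum fun i _ => ddd t ht i).const_mul _)
  have hsμ : ∀ t ≥ (0:ℝ), ∑ i, μd t i = (1 / 2) * (∑ i, Pin i - ∑ i, d t i) := by
    intro t ht
    rw [hdynμ t ht]
    simp only [Pi.smul_apply, Pi.sub_apply, smul_eq_mul, ← Finset.mul_sum, Finset.sum_sub_distrib,
      hsumL, sub_zero]
  have hμi : ∀ t i, μ t i = (Jm n *ᵥ μ t) i + (1 / (n:ℝ)) * ∑ j, μ t j := by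
    intro t i; rw [Jm_mulVec]; ring
  have BdW : Bd (fun t => ∑ i, μ t i - (1 / 2) * ∑ i, d t i) := by
    refine Bd.barrier hWd (n * Kb + MS) (-(n * Kb + MS)) ?_ ?_
    · intro t ht hlt
      have hS := abs_le.1 (hMS t ht)
      have hm : Kb ≤ (1 / (n:ℝ)) * ∑ j, μ t j := by
        rw [div_mul_eq_mul_div, one_mul, le_div_iff₀ hnR]; linarith [abs_nonneg (∑ i, d t i)]
      have hdd : ∀ i, dd t i = dhi i - d t i := by
        intro i
        rw [hdynd t ht i, min_eq_left, max_eq_right (hbox i)]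
        have h1 := (abs_le.1 (hMb i t ht)).1
        have h2 := hKbi i
        have h3 := le_abs_self (Mb i)
        have h4 := le_abs_self (dhi i)
        have h5 := abs_nonneg (dlo i)
        have h6 := hμi t i
        simp only [Pi.sub_apply]
        linarith
      rw [hsμ t ht]
      simp only [hdd, Finset.sum_sub_distrib]
      linarith
    · intro t ht hlt
      have hS := abs_le.1 (hMS t ht)
      have hm : (1 / (n:ℝ)) * ∑ j, μ t j ≤ - Kb := by
        rw [div_mul_eq_mul_div, one_mul, div_le_iff₀ hnR]; linarith [abs_nonneg (∑ i, d t i)]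
      have hdd : ∀ i, dd t i = dlo i - d t i := by
        intro i
        rw [hdynd t ht i, max_eq_left]
        refine (min_le_right _ _).trans ?_
        have h1 := (abs_le.1 (hMb i t ht)).2
        have h2 := hKbi i
        have h3 := le_abs_self (Mb i)
        have h4 := neg_abs_le (dlo i)
        have h5 := abs_nonneg (dhi i)
        have h6 := hμi t i
        simp only [Pi.sub_apply]
        linarith
      rw [hsμ t ht]
      simp only [hdd, Finset.sum_sub_distrib]
      linarith
  have Bdμ : ∀ i, Bd (fun t => μ t i) := by
    intro i
    have hs := (BdW.add (Bd.cmul (1 / 2) ⟨MS, hMS⟩)).cmul (1 / (n:ℝ))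
    have := (BdJμ i).add hs
    refine (funext fun t => ?_ : (fun t => μ t i) = _) ▸ this
    rw [hμi t i]; ring
  have Bdθ : ∀ i, Bd (fun t => θh t i) := by
    intro i
    have := (Bdφ i).add ((Bd.mulVec L Bdμ i).cmul 2)
    simpa using this
  obtain ⟨M1, h1⟩ := Bd.norm Bdη
  obtain ⟨M2, h2⟩ := Bd.norm Bdd
  obtain ⟨M3, h3⟩ := Bd.norm Bdθ
  obtain ⟨M4, h4⟩ := Bd.norm BdP
  obtain ⟨M5, h5⟩ := Bd.norm Bdω
  obtain ⟨M6, h6⟩ := Bd.norm Bdμ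
  refine ⟨|M1| + |M2| + |M3| + |M4| + |M5| + |M6|, fun t ht => ?_⟩
  have a1 := le_abs_self M1
  have a2 := le_abs_self M2
  have a3 := le_abs_self M3
  have a4 := le_abs_self M4
  have a5 := le_abs_self M5
  have a6 := le_abs_self M6
  have b1 := abs_nonneg M1
  have b2 := abs_nonneg M2
  have b3 := abs_nonneg M3
  have b4 := abs_nonneg M4
  have b5 := abs_nonneg M5
  have b6 := abs_nonneg M6
  have := h1 t ht
  have := h2 t ht
  have := h3 t ht
  have := h4 t ht
  have := h5 t ht
  have := h6 t ht
  refine ⟨?_, ?_, ?_, ?_, ?_, ?_⟩ <;> linarith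
end

section
/- Consider the DPPD dynamics without line-limit constraints as in the boundedness statement (same hypotheses: κ ∈ (0,1), continuously differentiable trajectory (η, d, θ̂, P, ω, μ) on [0,∞) satisfying the system, d(0) ∈ Ω, and existence of d̃ in the interior of Ω and θ̃ with P^in − d̃ − C B Cᵀ θ̃ = 0). Then the trajectory converges as t → ∞ to a point (η*, d*, θ̂*, P*, ω*, μ*) at which all right-hand sides of the system vanish (an equilibrium); moreover ω* = 0 and (d*, θ̂*, ω*, P*) is an optimal solution of the problem: minimize Σᵢ (f_{i,0}(dᵢ) + f_{i,2}(dᵢ)) + (1/2)ωᵀDω over (d, θ̂, ω, P) subject to d ∈ Ω, P^in − d − Dω − CP = 0, and P^in − d − C B Cᵀ θ̂ = 0. -/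
open Matrix Filter


lemma dp_prox {f : ℝ → ℝ} (hf : ConvexOn ℝ Set.univ f) {y p : ℝ}
    (h : IsMinOn (fun x : ℝ => f x + (1 / 2) * (x - y) ^ 2) Set.univ p) (z : ℝ) :
    f p + (y - p) * (z - p) ≤ f z := by
  have key : ∀ a : ℝ, 0 < a → a ≤ 1 →
      f p + (y - p) * (z - p) ≤ f z + a * ((z - p) ^ 2 / 2) := by
    intro a ha ha1
    have h1 := h (Set.mem_univ ((1 - a) * p + a * z))
    have h2 := hf.2 (Set.mem_univ p) (Set.mem_univ z) (by linarith : 0 ≤ 1 - a) ha.le (by ring)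
    simp only [smul_eq_mul, Set.mem_ofPred_eq] at h1 h2
    have h3 : a * (f p + (y - p) * (z - p)) ≤ a * (f z + a * ((z - p) ^ 2 / 2)) := by
      nlinarith
    exact le_of_mul_le_mul_left h3 ha
  have ht : Tendsto (fun a : ℝ => f z + a * ((z - p) ^ 2 / 2)) (nhdsWithin 0 (Set.Ioi 0))
      (nhds (f z + 0 * ((z - p) ^ 2 / 2))) := by
    apply Tendsto.mono_left _ nhdsWithin_le_nhds
    exact (Continuous.tendsto (by fun_prop) 0)
  rw [zero_mul, add_zero] at ht
  refine ge_of_tendsto ht ?_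
  filter_upwards [Ioc_mem_nhdsGT (zero_lt_one (α := ℝ))] with a ha
  exact key a ha.1 ha.2

lemma dp_proj {lo hi y q : ℝ} (hl : lo ≤ hi) (hq : q = max lo (min hi y)) :
    q ∈ Set.Icc lo hi ∧ ∀ z ∈ Set.Icc lo hi, (y - q) * (z - q) ≤ 0 := by
  subst hq
  rcases le_total hi y with h | h
  · rw [min_eq_left h, max_eq_right hl]
    exact ⟨⟨hl, le_rfl⟩, fun z hz => by nlinarith [hz.2]⟩
  · rw [min_eq_right h]
    rcases le_total lo y with h' | h'
    · rw [max_eq_right h']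
      exact ⟨⟨h', h⟩, fun z hz => by simp⟩
    · rw [max_eq_left h']
      exact ⟨⟨le_rfl, hl⟩, fun z hz => by nlinarith [hz.1]⟩

/-- continuity of the derivative from the first-order convexity inequality -/
lemma dp_deriv_mono {f : ℝ → ℝ} {β : ℝ} 
    (h : ∀ x y : ℝ, f x + deriv f x * (y - x) + β / 2 * (y - x) ^ 2 ≤ f y) (x y : ℝ) :
    β * (x - y) ^ 2 ≤ (deriv f x - deriv f y) * (x - y) := by
  nlinarith [h x y, h y x]

lemma dp_deriv_cont {f : ℝ → ℝ} {β : ℝ} (hβ : 1 < β) (hd : Differentiable ℝ f)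
    (h : ∀ x y : ℝ, f x + deriv f x * (y - x) + β / 2 * (y - x) ^ 2 ≤ f y) :
    Continuous (deriv f) := by
  have hm : Monotone (deriv f) := by
    intro x y hxy
    rcases hxy.eq_or_lt with rfl | hlt
    · rfl
    · by_contra hc
      push Not at hc
      nlinarith [dp_deriv_mono h x y, sq_nonneg (x - y), mul_pos (sub_pos.2 hlt) (sub_pos.2 hc)]
  have hoc : (Set.range (deriv f)).OrdConnected := by
    have := Set.OrdConnected.image_deriv (s := Set.univ) (f := f) Set.ordConnected_univ 
      (fun x _ => hd x)
    rwa [Set.image_univ] at this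
  refine hm.continuous_of_surjective fun y => ?_
  have hA := dp_deriv_mono h (|y - deriv f 0| + 1) 0
  have hB := dp_deriv_mono h (-(|y - deriv f 0| + 1)) 0
  have ha := abs_nonneg (y - deriv f 0)
  have h1 := le_abs_self (y - deriv f 0)
  have h2 := neg_abs_le (y - deriv f 0)
  generalize |y - deriv f 0| = a at *
  have hpos : 0 < a + 1 := by linarith
  have hA' : β * (a + 1) ≤ deriv f (a + 1) - deriv f 0 := by
    refine le_of_mul_le_mul_right ?_ hpos
    nlinarith
  have hB' : β * (a + 1) ≤ deriv f 0 - deriv f (-(a + 1)) := by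
    refine le_of_mul_le_mul_right ?_ hpos
    nlinarith
  exact hoc.out (Set.mem_range_self (-(a + 1))) (Set.mem_range_self (a + 1))
    ⟨by nlinarith, by nlinarith⟩

lemma dp_subgrad {g : ℝ → ℝ} (hg : ConvexOn ℝ Set.univ g) (x s : ℝ)
    (h1 : derivWithin g (Set.Iio x) x ≤ s) (h2 : s ≤ derivWithin g (Set.Ioi x) x) (y : ℝ) :
    g x + s * (y - x) ≤ g y := by
  rcases lt_trichotomy y x with h | h | h
  · have := (hg.slope_le_leftDeriv_of_mem_interior (Set.mem_univ y) (by simp) h).trans h1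
    rw [slope_def_field, div_le_iff₀ (by linarith)] at this
    linarith
  · subst h; simp
  · have := h2.trans (hg.rightDeriv_le_slope_of_mem_interior (by simp) (Set.mem_univ y) h)
    rw [slope_def_field, le_div_iff₀ (by linarith)] at this
    linarith

lemma dp_scalar {f g : ℝ → ℝ} (hf : Differentiable ℝ f) (hg : ConvexOn ℝ Set.univ g)
    {lo hi : ℝ} (hl : lo < hi) (c : ℝ) :
    ∃ x ∈ Set.Icc lo hi, ∃ s : ℝ, (∀ y, g x + s * (y - x) ≤ g y) ∧
      ∀ y ∈ Set.Icc lo hi, 0 ≤ (deriv f x + s - c) * (y - x) := by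
  have hgc : Continuous g := by
    rw [← continuousOn_univ]; exact hg.continuousOn isOpen_univ
  have hfc := hf.continuous
  obtain ⟨x, hx, hmin⟩ := (isCompact_Icc (a := lo) (b := hi)).exists_isMinOn ⟨lo, by simp [hl.le]⟩
    (f := fun x => f x + g x - c * x) (by fun_prop)
  refine ⟨x, hx, ?_⟩
  have hxi : x ∈ interior (Set.univ : Set ℝ) := by simp
  have hr := hg.hasDerivWithinAt_rightDeriv_of_mem_interior hxi
  have hl' := hg.hasDerivWithinAt_leftDeriv_of_mem_interior hxi
  have hlr := hg.leftDeriv_le_rightDeriv_of_mem_interior hxi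
  have sub := dp_subgrad hg x
  set r := derivWithin g (Set.Ioi x) x
  set m := derivWithin g (Set.Iio x) x
  have hfd := (hf x).hasDerivAt
  set p := deriv f x
  have hR : x < hi → 0 ≤ p + r - c := by
    intro hxh
    have h1 := (hfd.hasDerivWithinAt (s := Set.Ioi x)).add hr |>.sub
      ((hasDerivWithinAt_id x (Set.Ioi x)).const_mul c)
    rw [hasDerivWithinAt_iff_tendsto_slope' (by simp)] at h1
    have := ge_of_tendsto (b := (0:ℝ)) h1 (by
      filter_upwards [Ioc_mem_nhdsGT hxh] with y hy
      have h2 := hmin (⟨hx.1.trans hy.1.le, hy.2⟩ : y ∈ Set.Icc lo hi)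
      simp only [Set.mem_ofPred_eq] at h2
      rw [slope_def_field]
      refine div_nonneg ?_ (by linarith [hy.1])
      simp only [Pi.add_apply, Pi.sub_apply, id]
      linarith)
    linarith
  have hL : lo < x → p + m - c ≤ 0 := by
    intro hxh
    have h1 := (hfd.hasDerivWithinAt (s := Set.Iio x)).add hl' |>.sub
      ((hasDerivWithinAt_id x (Set.Iio x)).const_mul c)
    rw [hasDerivWithinAt_iff_tendsto_slope' (by simp)] at h1
    have := le_of_tendsto (b := (0:ℝ)) h1 (by
      filter_upwards [Ico_mem_nhdsLT hxh] with y hy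
      have h2 := hmin (⟨hy.1, hy.2.le.trans hx.2⟩ : y ∈ Set.Icc lo hi)
      simp only [Set.mem_ofPred_eq] at h2
      rw [slope_def_field]
      refine div_nonpos_of_nonneg_of_nonpos ?_ (by linarith [hy.2])
      simp only [Pi.add_apply, Pi.sub_apply, id]
      linarith)
    linarith
  rcases lt_or_ge (c - p) m with h | h
  · refine ⟨m, sub m le_rfl hlr, fun y hy => ?_⟩
    have : ¬ lo < x := fun hh => by linarith [hL hh]
    exact mul_nonneg (by linarith) (by linarith [hy.1])
  rcases le_or_gt (c - p) r with h' | h'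
  · exact ⟨c - p, sub _ h h', fun y hy => by simp⟩
  · refine ⟨r, sub r hlr le_rfl, fun y hy => ?_⟩
    have : ¬ x < hi := fun hh => by linarith [hR hh]
    exact mul_nonneg_of_nonpos_of_nonpos (by linarith) (by linarith [hy.2])

lemma dp_multiplier {n : ℕ} {f g : Fin n → ℝ → ℝ} {β : ℝ} (hβ : 1 < β)
    (hf : ∀ i, Differentiable ℝ (f i))
    (h : ∀ i, ∀ x y : ℝ, f i x + deriv (f i) x * (y - x) + β / 2 * (y - x) ^ 2 ≤ f i y)
    (hg : ∀ i, ConvexOn ℝ Set.univ (g i)) {lo hi : Fin n → ℝ} {S : ℝ}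
    (hl : ∀ i, lo i < hi i) (hS1 : ∑ i, lo i ≤ S) (hS2 : S ≤ ∑ i, hi i) :
    ∃ (c : ℝ) (x s : Fin n → ℝ), ∑ i, x i = S ∧ (∀ i, x i ∈ Set.Icc (lo i) (hi i)) ∧
      (∀ i y, g i (x i) + s i * (y - x i) ≤ g i y) ∧
      ∀ i, ∀ y ∈ Set.Icc (lo i) (hi i), 0 ≤ (deriv (f i) (x i) + s i - c) * (y - x i) := by
  choose X hX s hs hk using fun (c : ℝ) (i : Fin n) => dp_scalar (hf i) (hg i) (hl i) c
  have mono : ∀ i, ∀ x y s t : ℝ, (∀ z, g i x + s * (z - x) ≤ g i z) →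
      (∀ z, g i y + t * (z - y) ≤ g i z) →
      (x - y) ^ 2 ≤ (deriv (f i) x + s - (deriv (f i) y + t)) * (x - y) := by
    intro i x y s t h1 h2
    nlinarith [h1 y, h2 x, dp_deriv_mono (h i) x y, sq_nonneg (x - y)]
  have hXc : ∀ i, Continuous (fun c => X c i) := by
    intro i
    refine (LipschitzWith.of_dist_le_mul (K := 1) fun c c' => ?_).continuous
    have h1 := mono i _ _ _ _ (hs c i) (hs c' i)
    have h2 := hk c i _ (hX c' i)
    have h3 := hk c' i _ (hX c i)
    rw [Real.dist_eq, Real.dist_eq, NNReal.coe_one, one_mul]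
    have h4 : (X c i - X c' i) ^ 2 ≤ (c - c') * (X c i - X c' i) := by nlinarith
    have h5 : |X c i - X c' i| * |X c i - X c' i| ≤ |c - c'| * |X c i - X c' i| := by
      rw [← abs_mul, ← abs_mul, ← sq, abs_sq]
      exact h4.trans (le_abs_self _)
    rcases (abs_nonneg (X c i - X c' i)).eq_or_lt with h0 | h0
    · rw [← h0]; exact abs_nonneg _
    · exact le_of_mul_le_mul_right h5 h0
  have hcont : Continuous (fun c => ∑ i, X c i) := continuous_finsetSum _ fun i _ => hXc i
  have htop : ∀ i, ∃ M : ℝ, ∀ c, M < c → X c i = hi i := by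
    intro i
    have hlr := (hg i).leftDeriv_le_rightDeriv_of_mem_interior (x := hi i) (by simp)
    refine ⟨deriv (f i) (hi i) + derivWithin (g i) (Set.Ioi (hi i)) (hi i), fun c hc => ?_⟩
    by_contra hne
    have hlt := lt_of_le_of_ne (hX c i).2 hne
    have h1 := mono i _ _ _ _ (hs c i) (dp_subgrad (hg i) (hi i) _ hlr le_rfl)
    have h2 := hk c i (hi i) ⟨(hl i).le, le_rfl⟩
    nlinarith [sq_nonneg (X c i - hi i), mul_pos (sub_pos.2 hc) (sub_pos.2 hlt)]
  have hbot : ∀ i, ∃ M : ℝ, ∀ c, c < M → X c i = lo i := by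
    intro i
    have hlr := (hg i).leftDeriv_le_rightDeriv_of_mem_interior (x := lo i) (by simp)
    refine ⟨deriv (f i) (lo i) + derivWithin (g i) (Set.Ioi (lo i)) (lo i), fun c hc => ?_⟩
    by_contra hne
    have hlt := lt_of_le_of_ne (hX c i).1 (Ne.symm hne)
    have h1 := mono i _ _ _ _ (hs c i) (dp_subgrad (hg i) (lo i) _ hlr le_rfl)
    have h2 := hk c i (lo i) ⟨le_rfl, (hl i).le⟩
    nlinarith [sq_nonneg (X c i - lo i), mul_pos (sub_pos.2 hc) (sub_pos.2 hlt)]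
  choose M1 hM1 using htop
  choose M2 hM2 using hbot
  have e1 : ∃ c, ∑ i, X c i ≤ S := by
    have : ∀ᶠ c in atBot, ∀ i, X c i = lo i := by
      rw [eventually_all]; intro i
      filter_upwards [eventually_lt_atBot (M2 i)] with c hc using hM2 i c hc
    obtain ⟨c, hc⟩ := this.exists
    exact ⟨c, by simpa [hc] using hS1⟩
  have e2 : ∃ c, S ≤ ∑ i, X c i := by
    have : ∀ᶠ c in atTop, ∀ i, X c i = hi i := by
      rw [eventually_all]; intro i
      filter_upwards [eventually_gt_atTop (M1 i)] with c hc using hM1 i c hc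
    obtain ⟨c, hc⟩ := this.exists
    exact ⟨c, by simpa [hc] using hS2⟩
  obtain ⟨a, ha⟩ := e1
  obtain ⟨b, hb⟩ := e2
  obtain ⟨c, hc⟩ := mem_range_of_exists_le_of_exists_ge hcont ⟨a, ha⟩ ⟨b, hb⟩
  exact ⟨c, X c, s c, hc, hX c, hs c, hk c⟩


lemma dp_dot {n l : ℕ} (C : Matrix (Fin n) (Fin l) ℝ) (x : Fin n → ℝ) (y : Fin l → ℝ) :
    ∑ i, x i * C.mulVec y i = ∑ e, Cᵀ.mulVec x e * y e := by
  have : x ⬝ᵥ C.mulVec y = Cᵀ.mulVec x ⬝ᵥ y := by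
    rw [Matrix.dotProduct_mulVec, Matrix.mulVec_transpose]
  exact this

lemma dp_diag {l : ℕ} {B : Matrix (Fin l) (Fin l) ℝ} (hB : ∀ e f, e ≠ f → B e f = 0)
    (x : Fin l → ℝ) (e : Fin l) : B.mulVec x e = B e e * x e := by
  rw [Matrix.mulVec, dotProduct]
  refine Finset.sum_eq_single e (fun f _ hf => ?_) (by simp)
  rw [hB e f hf.symm, zero_mul]

lemma dp_symm {n l : ℕ} (C : Matrix (Fin n) (Fin l) ℝ) {B : Matrix (Fin l) (Fin l) ℝ}
    (hB : ∀ e f, e ≠ f → B e f = 0) : (C * B * Cᵀ)ᵀ = C * B * Cᵀ := by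
  have : Bᵀ = B := by
    ext e f
    rcases eq_or_ne e f with rfl | h
    · rfl
    · rw [transpose_apply, hB e f h, hB f e h.symm]
  rw [transpose_mul, transpose_mul, transpose_transpose, this, Matrix.mul_assoc]

lemma dp_sumL {n l : ℕ} {C : Matrix (Fin n) (Fin l) ℝ}
    (hker : ∀ x : Fin n → ℝ, Cᵀ.mulVec x = 0 ↔ ∃ c : ℝ, x = fun _ => c) (p : Fin l → ℝ) :
    ∑ i, C.mulVec p i = 0 := by
  have := dp_dot C (fun _ => 1) p
  rw [(hker _).2 ⟨1, rfl⟩] at this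
  simpa using this

lemma dp_assoc {n l : ℕ} (C : Matrix (Fin n) (Fin l) ℝ) (B : Matrix (Fin l) (Fin l) ℝ)
    (x : Fin n → ℝ) : (C * B * Cᵀ).mulVec x = C.mulVec (B.mulVec (Cᵀ.mulVec x)) := by
  simp [Matrix.mulVec_mulVec, Matrix.mul_assoc]

lemma dp_surj {n l : ℕ} (hn : 0 < n) {C : Matrix (Fin n) (Fin l) ℝ}
    (hker : ∀ x : Fin n → ℝ, Cᵀ.mulVec x = 0 ↔ ∃ c : ℝ, x = fun _ => c)
    {B : Matrix (Fin l) (Fin l) ℝ} (hB : ∀ e f, e ≠ f → B e f = 0) (hBpos : ∀ e, 0 < B e e)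
    (w : Fin n → ℝ) (hw : ∑ i, w i = 0) : ∃ θ, (C * B * Cᵀ).mulVec θ = w := by
  have hn' : (n : ℝ) ≠ 0 := by positivity
  let T : (Fin n → ℝ) →ₗ[ℝ] (Fin n → ℝ) := Matrix.mulVecLin (C * B * Cᵀ + Matrix.of fun _ _ => (1:ℝ))
  have hT : ∀ x i, T x i = (C * B * Cᵀ).mulVec x i + ∑ j, x j := by
    intro x i
    simp only [T, Matrix.mulVecLin_apply, Matrix.add_mulVec, Pi.add_apply]
    congr 1
    simp [Matrix.mulVec, dotProduct]
  have hsum : ∀ x, ∑ i, T x i = n * ∑ j, x j := by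
    intro x
    simp only [hT, Finset.sum_add_distrib, dp_assoc, dp_sumL hker]
    simp
  have hinj : Function.Injective T := by
    rw [← LinearMap.ker_eq_bot, LinearMap.ker_eq_bot']
    intro x hx
    have h0 : ∑ j, x j = 0 := by
      have := hsum x
      rw [hx] at this
      simpa [hn'] using this
    have h1 : (C * B * Cᵀ).mulVec x = 0 := by
      ext i
      have := hT x i
      rw [hx, h0] at this
      simpa using this.symm
    have h2 : ∑ e, B e e * (Cᵀ.mulVec x e) ^ 2 = 0 := by
      have := dp_dot C x (B.mulVec (Cᵀ.mulVec x))
      rw [← dp_assoc, h1] at this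
      simp only [Pi.zero_apply, mul_zero, Finset.sum_const_zero] at this
      rw [this]
      refine Finset.sum_congr rfl fun e _ => ?_
      rw [dp_diag hB]; ring
    have h3 : Cᵀ.mulVec x = 0 := by
      ext e
      have := (Finset.sum_eq_zero_iff_of_nonneg (fun e _ =>
        mul_nonneg (hBpos e).le (sq_nonneg _))).1 h2 e (Finset.mem_univ e)
      simpa [(hBpos e).ne'] using this
    obtain ⟨c, rfl⟩ := (hker x).1 h3
    have : c = 0 := by simpa [hn'] using h0
    subst this; rfl
  obtain ⟨θ, hθ⟩ := LinearMap.injective_iff_surjective.1 hinj w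
  refine ⟨θ, ?_⟩
  have h0 : ∑ j, θ j = 0 := by
    have := hsum θ
    rw [hθ, hw] at this
    simpa [hn'] using this.symm
  ext i
  have := hT θ i
  rw [hθ, h0] at this
  simpa using this.symm

/-- Variational form of an equilibrium with zero frequency deviation. -/
structure DPEq {n l : ℕ} (C : Matrix (Fin n) (Fin l) ℝ) (L : Matrix (Fin n) (Fin n) ℝ)
    (Pin dlo dhi : Fin n → ℝ) (f0 f2 : Fin n → ℝ → ℝ) (κ : ℝ)
    (ηs ds θs μs : Fin n → ℝ) (Ps : Fin l → ℝ) : Prop where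
  sub : ∀ i y, f2 i (ds i) + (-(κ * ηs i)) * (y - ds i) ≤ f2 i y
  mem : ∀ i, ds i ∈ Set.Icc (dlo i) (dhi i)
  nrm : ∀ i, ∀ y ∈ Set.Icc (dlo i) (dhi i),
    0 ≤ (deriv (f0 i) (ds i) - κ * ηs i - μs i) * (y - ds i)
  mu : L.mulVec μs = 0
  bal1 : Pin - ds - C.mulVec Ps = 0
  bal2 : Pin - ds - L.mulVec θs = 0

lemma dp_exists_eq {n l : ℕ} (hn : 0 < n) {C : Matrix (Fin n) (Fin l) ℝ}
    (hker : ∀ x : Fin n → ℝ, Cᵀ.mulVec x = 0 ↔ ∃ c : ℝ, x = fun _ => c)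
    {B : Matrix (Fin l) (Fin l) ℝ} (hB : ∀ e f, e ≠ f → B e f = 0) (hBpos : ∀ e, 0 < B e e)
    {Pin dlo dhi : Fin n → ℝ} {f0 f2 : Fin n → ℝ → ℝ} {β κ : ℝ} (hβ : 1 < β)
    (hf : ∀ i, Differentiable ℝ (f0 i))
    (h : ∀ i, ∀ x y : ℝ, f0 i x + deriv (f0 i) x * (y - x) + β / 2 * (y - x) ^ 2 ≤ f0 i y)
    (hg : ∀ i, ConvexOn ℝ Set.univ (f2 i)) (hκ : κ ∈ Set.Ioo (0:ℝ) 1)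
    (hfeasible : ∃ (dt θt : Fin n → ℝ),
      (∀ i, dlo i < dt i ∧ dt i < dhi i) ∧ Pin - dt - (C * B * Cᵀ).mulVec θt = 0) :
    ∃ ηs ds θs μs Ps, DPEq C (C * B * Cᵀ) Pin dlo dhi f0 f2 κ ηs ds θs μs Ps := by
  obtain ⟨dt, θt, hdt, hbal⟩ := hfeasible
  have hS : ∑ i, dt i = ∑ i, Pin i := by
    have h1 := dp_sumL hker (B.mulVec (Cᵀ.mulVec θt))
    rw [← dp_assoc, ← sub_eq_zero.1 hbal] at h1
    simp only [Pi.sub_apply, Finset.sum_sub_distrib] at h1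
    linarith
  obtain ⟨c, x, s, hx, hmem, hs, hk⟩ := dp_multiplier hβ hf h hg (S := ∑ i, Pin i)
    (fun i => (hdt i).1.trans (hdt i).2)
    (hS ▸ Finset.sum_le_sum fun i _ => (hdt i).1.le)
    (hS ▸ Finset.sum_le_sum fun i _ => (hdt i).2.le)
  obtain ⟨θ, hθ⟩ := dp_surj hn hker hB hBpos (Pin - x) (by
    simp [Finset.sum_sub_distrib, hx])
  have hκ0 := hκ.1.ne'
  have e : ∀ i, κ * (-(s i) / κ) = - s i := fun i => by field_simp
  refine ⟨fun i => -(s i) / κ, x, θ, fun _ => c, B.mulVec (Cᵀ.mulVec θ), ?_, hmem, ?_, ?_, ?_, ?_⟩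
  · intro i y; rw [e, neg_neg]; exact hs i y
  · intro i y hy; rw [e]; have := hk i y hy; rwa [sub_neg_eq_add]
  · rw [dp_assoc, (hker _).2 ⟨c, rfl⟩]; simp
  · rw [← dp_assoc, hθ, sub_self]
  · rw [hθ, sub_self]

/-- Pointwise Lyapunov inequality. -/
lemma dp_lyap {n l : ℕ} {C : Matrix (Fin n) (Fin l) ℝ} {L : Matrix (Fin n) (Fin n) ℝ}
    (hL : Lᵀ = L) {κ β : ℝ} (hβ : 1 < β) {Dd δ η e v F ω u1 u1d μ u2 u2d θ θd : Fin n → ℝ}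
    {P Pd : Fin l → ℝ} (hD : ∀ i, 0 < Dd i)
    (h_prox : ∀ i, 0 ≤ (- e i - κ * η i) * (e i + δ i))
    (h_proj : ∀ i, 0 ≤ (- v i - (F i - κ * η i - ω i - μ i - u1 i - u2 i)) * (v i + δ i))
    (hF : ∀ i, β * δ i ^ 2 ≤ F i * δ i)
    (hu1 : ∀ i, u1 i = - δ i - Dd i * ω i - C.mulVec P i)
    (hu2 : ∀ i, u2 i = - δ i - L.mulVec θ i)
    (hu1d : ∀ i, u1d i = - v i - Dd i * (1 / 2 * u1 i) - C.mulVec Pd i)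
    (hu2d : ∀ i, u2d i = - v i - L.mulVec θd i)
    (hPd : Pd = Cᵀ.mulVec (ω + u1)) (hθd : θd = L.mulVec (μ + u2)) :
    (∑ i, (κ * η i * e i + δ i * v i + F i * v i - κ * (e i * δ i + η i * v i)
      + (1 / 2 * u1 i * u1 i + ω i * u1d i + u1 i * u1d i + ω i * u1 i
          + 3 / 2 * Dd i * ω i * u1 i)
      + (1 / 2 * u2 i * u2 i + μ i * u2d i + u2 i * u2d i + θ i * θd i + μ i * u2 i)))
      + ∑ j, P j * Pd j
    ≤ - ((∑ i, (v i ^ 2 + (1 - (1 + κ) ^ 2 / 4) * e i ^ 2 + 1 / 2 * u1 i ^ 2 + Dd i * ω i ^ 2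
      + 1 / 2 * u2 i ^ 2 + θd i ^ 2)) + ∑ j, Pd j ^ 2) := by
  have hA := dp_dot C (ω + u1) P
  have hB := dp_dot C (ω + u1) Pd
  have hA' := dp_dot L (μ + u2) θ
  have hB' := dp_dot L (μ + u2) θd
  rw [hL, ← hθd] at hA' hB'
  rw [← hPd] at hA hB
  have e1 : ∑ j, P j * Pd j = ∑ i, (ω + u1) i * C.mulVec P i := by
    rw [hA]; exact Finset.sum_congr rfl fun _ _ => mul_comm _ _
  have e2 : ∑ j, Pd j ^ 2 = ∑ i, (ω + u1) i * C.mulVec Pd i := by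
    rw [hB]; exact Finset.sum_congr rfl fun _ _ => sq _
  have e3 : ∑ i, θd i * θ i = ∑ i, (μ + u2) i * L.mulVec θ i := hA'.symm
  have e4 : ∑ i, θd i * θd i = ∑ i, (μ + u2) i * L.mulVec θd i := hB'.symm
  rw [e1, e2]
  have key : ∑ i, ((κ * η i * e i + δ i * v i + F i * v i - κ * (e i * δ i + η i * v i)
      + (1 / 2 * u1 i * u1 i + ω i * u1d i + u1 i * u1d i + ω i * u1 i
          + 3 / 2 * Dd i * ω i * u1 i)
      + (1 / 2 * u2 i * u2 i + μ i * u2d i + u2 i * u2d i + θ i * θd i + μ i * u2 i))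
      + (v i ^ 2 + (1 - (1 + κ) ^ 2 / 4) * e i ^ 2 + 1 / 2 * u1 i ^ 2 + Dd i * ω i ^ 2
      + 1 / 2 * u2 i ^ 2 + θd i ^ 2) + (ω + u1) i * C.mulVec P i + (ω + u1) i * C.mulVec Pd i
      - (θd i * θ i - (μ + u2) i * L.mulVec θ i) - (θd i * θd i - (μ + u2) i * L.mulVec θd i)) 
      ≤ 0 := by
    refine Finset.sum_nonpos fun i _ => ?_
    have a1 := h_prox i
    have a2 := h_proj i
    have a3 := hF i
    have a4 : C.mulVec P i = - δ i - Dd i * ω i - u1 i := by rw [hu1 i]; ring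
    have a5 : C.mulVec Pd i = - v i - Dd i * (1 / 2 * u1 i) - u1d i := by rw [hu1d i]; ring
    have a6 : L.mulVec θ i = - δ i - u2 i := by rw [hu2 i]; ring
    have a7 : L.mulVec θd i = - v i - u2d i := by rw [hu2d i]; ring
    have a8 : 0 ≤ Dd i * u1 i ^ 2 := mul_nonneg (hD i).le (sq_nonneg _)
    have a9 : 0 ≤ (β - 1) * δ i ^ 2 := mul_nonneg (by linarith) (sq_nonneg _)
    rw [a4, a5, a6, a7, Pi.add_apply, Pi.add_apply]
    nlinarith [sq_nonneg (δ i + (1 + κ) / 2 * e i)]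
  simp only [Finset.sum_add_distrib, Finset.sum_sub_distrib] at key e1 e2 e3 e4 ⊢
  linarith


lemma dp_decay {V W : ℝ → ℝ} (hV : ∀ t ≥ (0:ℝ), 0 ≤ V t) (hW : ∀ t ≥ (0:ℝ), 0 ≤ W t)
    (h : ∀ t ≥ (0:ℝ), ∃ V', HasDerivWithinAt V V' (Set.Ici 0) t ∧ V' ≤ - W t) :
    AntitoneOn V (Set.Ici 0) ∧ ∀ T ε : ℝ, 0 < ε → ∃ t ≥ T, 0 ≤ t ∧ W t < ε := by
  choose! V' hd hle using h
  have hc : ContinuousOn V (Set.Ici 0) := fun t ht => (hd t ht).continuousWithinAt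
  refine ⟨antitoneOn_of_hasDerivWithinAt_nonpos (f' := V') (convex_Ici 0) hc ?_ ?_, ?_⟩
  · intro x hx
    exact (hd x (interior_subset hx)).mono interior_subset
  · intro x hx
    have := interior_subset hx
    linarith [hle x this, hW x this]
  · intro T ε hε
    by_contra hcon
    push Not at hcon
    have hsub : Set.Ici (max T 0) ⊆ Set.Ici 0 := Set.Ici_subset_Ici.2 (le_max_right _ _)
    have hanti : AntitoneOn (fun t => V t + ε * t) (Set.Ici (max T 0)) := by
      refine antitoneOn_of_hasDerivWithinAt_nonpos (f' := fun t => V' t + ε * 1) (convex_Ici _) ?_ ?_ ?_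
      · exact (hc.mono hsub).add (by fun_prop)
      · intro x hx
        have hx' := interior_subset hx
        exact ((hd x (hsub hx')).mono (interior_subset.trans hsub)).add
          ((hasDerivWithinAt_id _ _).const_mul ε)
      · intro x hx
        have hx' := interior_subset hx
        have h1 := hcon x ((le_max_left _ _).trans hx') (hsub hx')
        linarith [hle x (hsub hx')]
    set a := max T 0 with ha
    have ha0 : 0 ≤ a := le_max_right _ _
    have hp : 0 ≤ V a / ε := div_nonneg (hV a ha0) hε.le
    have h1 := hanti (Set.mem_Ici.2 le_rfl) (Set.mem_Ici.2 (by linarith : a ≤ a + (V a / ε + 1)))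
      (by linarith)
    have h2 := hV (a + (V a / ε + 1)) (by linarith)
    simp only at h1
    have h3 : ε * (V a / ε) = V a := by field_simp
    nlinarith

/-- Lyapunov function. -/
noncomputable def dpV {n l : ℕ} (κ : ℝ) (f0 : Fin n → ℝ → ℝ) (Dd ηs ds θs μs : Fin n → ℝ)
    (Ps : Fin l → ℝ) (η d θ ω μ u1 u2 : Fin n → ℝ) (P : Fin l → ℝ) : ℝ :=
  (∑ i, (κ / 2 * (η i - ηs i) ^ 2 + 1 / 2 * (d i - ds i) ^ 2
      + (f0 i (d i) - f0 i (ds i) - deriv (f0 i) (ds i) * (d i - ds i))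
      - κ * ((η i - ηs i) * (d i - ds i))
    + (ω i * u1 i + 1 / 2 * u1 i ^ 2 + ω i ^ 2 + 3 / 2 * Dd i * ω i ^ 2)
    + ((μ i - μs i) * u2 i + 1 / 2 * u2 i ^ 2 + 1 / 2 * (θ i - θs i) ^ 2 + (μ i - μs i) ^ 2)))
  + ∑ j, 1 / 2 * (P j - Ps j) ^ 2

lemma dpV_lower {n l : ℕ} {κ β : ℝ} {f0 : Fin n → ℝ → ℝ} {Dd : Fin n → ℝ}
    (hκ : κ ∈ Set.Ioo (0:ℝ) 1) (hβ : 1 < β) (hD : ∀ i, 0 < Dd i)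
    (h : ∀ i, ∀ x y : ℝ, f0 i x + deriv (f0 i) x * (y - x) + β / 2 * (y - x) ^ 2 ≤ f0 i y)
    (ηs ds θs μs : Fin n → ℝ) (Ps : Fin l → ℝ) (η d θ ω μ u1 u2 : Fin n → ℝ) (P : Fin l → ℝ) :
    (∑ i, (κ / 2 * ((η i - ηs i) - (d i - ds i)) ^ 2 + 1 / 2 * (d i - ds i) ^ 2 
      + 1 / 2 * ω i ^ 2 + 1 / 2 * (θ i - θs i) ^ 2 + 1 / 2 * (μ i - μs i) ^ 2))
      + ∑ j, 1 / 2 * (P j - Ps j) ^ 2 ≤ dpV κ f0 Dd ηs ds θs μs Ps η d θ ω μ u1 u2 P := by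
  unfold dpV
  refine add_le_add (Finset.sum_le_sum fun i _ => ?_) le_rfl
  have a1 := h i (ds i) (d i)
  have a2 : 0 ≤ Dd i * ω i ^ 2 := mul_nonneg (hD i).le (sq_nonneg _)
  have a3 : 0 ≤ (β - κ) * (d i - ds i) ^ 2 := mul_nonneg (by linarith [hκ.2]) (sq_nonneg _)
  nlinarith [sq_nonneg (ω i + u1 i), sq_nonneg (μ i - μs i + u2 i)]

lemma dpV_coord {n l : ℕ} {κ β : ℝ} {f0 : Fin n → ℝ → ℝ} {Dd : Fin n → ℝ}
    (hκ : κ ∈ Set.Ioo (0:ℝ) 1) (hβ : 1 < β) (hD : ∀ i, 0 < Dd i)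
    (h : ∀ i, ∀ x y : ℝ, f0 i x + deriv (f0 i) x * (y - x) + β / 2 * (y - x) ^ 2 ≤ f0 i y)
    (ηs ds θs μs : Fin n → ℝ) (Ps : Fin l → ℝ) (η d θ ω μ u1 u2 : Fin n → ℝ) (P : Fin l → ℝ)
    {v : ℝ} (hv : dpV κ f0 Dd ηs ds θs μs Ps η d θ ω μ u1 u2 P ≤ v) :
    0 ≤ v ∧ (∀ i, |η i - ηs i| ≤ √(2 * v / κ) + √(2 * v) ∧ |d i - ds i| ≤ √(2 * v) ∧ 
      |ω i| ≤ √(2 * v) ∧ 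
      |θ i - θs i| ≤ √(2 * v) ∧ |μ i - μs i| ≤ √(2 * v)) ∧ ∀ j, |P j - Ps j| ≤ √(2 * v) := by
  have hlow := (dpV_lower hκ hβ hD h ηs ds θs μs Ps η d θ ω μ u1 u2 P).trans hv
  have hκ0 := hκ.1
  have p1 : ∀ i ∈ Finset.univ, 0 ≤ (κ / 2 * ((η i - ηs i) - (d i - ds i)) ^ 2 + 1 / 2 * (d i - ds i) ^ 2 
      + 1 / 2 * ω i ^ 2 + 1 / 2 * (θ i - θs i) ^ 2 + 1 / 2 * (μ i - μs i) ^ 2) := 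
    fun i _ => by positivity
  have p2 : ∀ j ∈ Finset.univ, 0 ≤ 1 / 2 * (P j - Ps j) ^ 2 := fun j _ => by positivity
  refine ⟨(add_nonneg (Finset.sum_nonneg p1) (Finset.sum_nonneg p2)).trans hlow,
    fun i => ?_, fun j => ?_⟩
  · have h1 := Finset.single_le_sum p1 (Finset.mem_univ i)
    have h2 := Finset.sum_nonneg p2
    have b1 : 0 ≤ κ / 2 * ((η i - ηs i) - (d i - ds i)) ^ 2 := by positivity
    have b2 := sq_nonneg (d i - ds i)
    have b3 := sq_nonneg (ω i)
    have b4 := sq_nonneg (θ i - θs i)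
    have b5 := sq_nonneg (μ i - μs i)
    have c1 : |d i - ds i| ≤ √(2 * v) := Real.abs_le_sqrt (by linarith)
    have c2 : |(η i - ηs i) - (d i - ds i)| ≤ √(2 * v / κ) := by
      refine Real.abs_le_sqrt ?_
      rw [le_div_iff₀ hκ0]
      linarith
    refine ⟨?_, c1, Real.abs_le_sqrt (by linarith), Real.abs_le_sqrt (by linarith),
      Real.abs_le_sqrt (by linarith)⟩
    calc |η i - ηs i| = |((η i - ηs i) - (d i - ds i)) + (d i - ds i)| := by ring_nf
      _ ≤ _ := abs_add_le _ _
      _ ≤ _ := add_le_add c2 c1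
  · have h1 := Finset.single_le_sum p2 (Finset.mem_univ j)
    have h2 := Finset.sum_nonneg p1
    exact Real.abs_le_sqrt (by linarith)

lemma dpV_deriv {n l : ℕ} {κ : ℝ} {f0 : Fin n → ℝ → ℝ} {Dd : Fin n → ℝ}
    (hf : ∀ i, Differentiable ℝ (f0 i))
    (ηs ds θs μs : Fin n → ℝ) (Ps : Fin l → ℝ)
    {η d θ ω μ u1 u2 : ℝ → Fin n → ℝ} {P : ℝ → Fin l → ℝ}
    {e v θd ωd μd u1d u2d : Fin n → ℝ} {Pd : Fin l → ℝ} {s : Set ℝ} {t : ℝ}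
    (h1 : HasDerivWithinAt η e s t) (h2 : HasDerivWithinAt d v s t)
    (h3 : HasDerivWithinAt θ θd s t) (h4 : HasDerivWithinAt ω ωd s t)
    (h5 : HasDerivWithinAt μ μd s t) (h6 : HasDerivWithinAt u1 u1d s t)
    (h7 : HasDerivWithinAt u2 u2d s t) (h8 : HasDerivWithinAt P Pd s t)
    (hω : ∀ i, ωd i = 1 / 2 * u1 t i) (hμ : ∀ i, μd i = 1 / 2 * u2 t i) :
    HasDerivWithinAt (fun t => dpV κ f0 Dd ηs ds θs μs Ps (η t) (d t) (θ t) (ω t) (μ t)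
      (u1 t) (u2 t) (P t))
      ((∑ i, (κ * (η t i - ηs i) * e i + (d t i - ds i) * v i
        + (deriv (f0 i) (d t i) - deriv (f0 i) (ds i)) * v i
        - κ * (e i * (d t i - ds i) + (η t i - ηs i) * v i)
      + (1 / 2 * u1 t i * u1 t i + ω t i * u1d i + u1 t i * u1d i + ω t i * u1 t i
          + 3 / 2 * Dd i * ω t i * u1 t i)
      + (1 / 2 * u2 t i * u2 t i + (μ t i - μs i) * u2d i + u2 t i * u2d i
          + (θ t i - θs i) * θd i + (μ t i - μs i) * u2 t i)))
      + ∑ j, (P t j - Ps j) * Pd j) s t := by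
  unfold dpV
  rw [hasDerivWithinAt_pi] at h1 h2 h3 h4 h5 h6 h7 h8
  refine HasDerivWithinAt.add (HasDerivWithinAt.fun_sum fun i _ => ?_)
    (HasDerivWithinAt.fun_sum fun j _ => ?_)
  · have a1 := (h1 i).sub_const (ηs i)
    have a2 := (h2 i).sub_const (ds i)
    have a3 := (h3 i).sub_const (θs i)
    have a4 := h4 i
    have a5 := (h5 i).sub_const (μs i)
    have a6 := h6 i
    have a7 := h7 i
    have a8 : HasDerivWithinAt (fun t => f0 i (d t i)) (deriv (f0 i) (d t i) * v i) s t :=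
      (hf i (d t i)).hasDerivAt.comp_hasDerivWithinAt t (h2 i)
    have := (((((a1.pow 2).const_mul (κ / 2)).add ((a2.pow 2).const_mul (1 / 2))).add
      ((a8.sub_const (f0 i (ds i))).sub (a2.const_mul (deriv (f0 i) (ds i))))).sub
      ((a1.mul a2).const_mul κ)).add
      ((((a4.mul a6).add ((a6.pow 2).const_mul (1 / 2))).add (a4.pow 2)).add
        ((a4.pow 2).const_mul (3 / 2 * Dd i)))
    have := this.add ((((a5.mul a7).add ((a7.pow 2).const_mul (1 / 2))).add
      ((a3.pow 2).const_mul (1 / 2))).add (a5.pow 2))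
    refine this.congr_deriv ?_
    rw [hω i, hμ i]
    push_cast
    ring
  · refine ((((h8 j).sub_const (Ps j)).pow 2).const_mul (1 / 2)).congr_deriv ?_
    push_cast
    ring

lemma dp_mulVec_deriv {n l : ℕ} (C : Matrix (Fin n) (Fin l) ℝ) {P : ℝ → Fin l → ℝ}
    {Pd : Fin l → ℝ} {s : Set ℝ} {t : ℝ} (h : HasDerivWithinAt P Pd s t) :
    HasDerivWithinAt (fun t => C.mulVec (P t)) (C.mulVec Pd) s t :=
  (LinearMap.toContinuousLinearMap C.mulVecLin).hasFDerivAt.comp_hasDerivWithinAt t h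

/-- A continuously differentiable DPPD trajectory (no line limits) with
`d(0) ∈ Ω` converges to an equilibrium `(η*, d*, θ̂*, P*, ω*, μ*)` of the dynamics;
moreover `ω* = 0` and `(d*, θ̂*, ω*, P*)` is optimal for the problem without line
limits. -/
theorem dppd_trajectory_converges
    {n l : ℕ} (hn : 0 < n) (hl : 0 < l)
    (C : Matrix (Fin n) (Fin l) ℝ)
    (hC1 : Matrix.vecMul (fun _ => (1:ℝ)) C = 0)
    (hker : ∀ x : Fin n → ℝ, Cᵀ.mulVec x = 0 ↔ ∃ c : ℝ, x = fun _ => c)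
    (B : Matrix (Fin l) (Fin l) ℝ)
    (hBdiag : ∀ e f, e ≠ f → B e f = 0) (hBpos : ∀ e, 0 < B e e)
    (D : Matrix (Fin n) (Fin n) ℝ)
    (hDdiag : ∀ i j, i ≠ j → D i j = 0) (hDpos : ∀ i, 0 < D i i)
    (Pin : Fin n → ℝ)
    (dlo dhi : Fin n → ℝ) (hbox : ∀ i, dlo i ≤ dhi i)
    (f0 : Fin n → ℝ → ℝ) (hf0diff : ∀ i, Differentiable ℝ (f0 i))
    (β : ℝ) (hβ : 1 < β)
    (hf0sc : ∀ (i : Fin n) (x y : ℝ),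
      f0 i x + deriv (f0 i) x * (y - x) + β / 2 * (y - x) ^ 2 ≤ f0 i y)
    (f2 : Fin n → ℝ → ℝ) (hf2conv : ∀ i, ConvexOn ℝ Set.univ (f2 i))
    (κ : ℝ) (hκ : κ ∈ Set.Ioo (0:ℝ) 1)
    -- the trajectory and its derivatives
    (η d ω μ θh : ℝ → Fin n → ℝ) (P : ℝ → Fin l → ℝ)
    (ηd dd ωd μd θhd : ℝ → Fin n → ℝ) (Pd : ℝ → Fin l → ℝ)
    (hηD : ∀ t ≥ (0:ℝ), HasDerivWithinAt η (ηd t) (Set.Ici 0) t)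
    (hdD : ∀ t ≥ (0:ℝ), HasDerivWithinAt d (dd t) (Set.Ici 0) t)
    (hωD : ∀ t ≥ (0:ℝ), HasDerivWithinAt ω (ωd t) (Set.Ici 0) t)
    (hμD : ∀ t ≥ (0:ℝ), HasDerivWithinAt μ (μd t) (Set.Ici 0) t)
    (hθD : ∀ t ≥ (0:ℝ), HasDerivWithinAt θh (θhd t) (Set.Ici 0) t)
    (hPD : ∀ t ≥ (0:ℝ), HasDerivWithinAt P (Pd t) (Set.Ici 0) t)
    (hηC : ContinuousOn ηd (Set.Ici 0)) (hdC : ContinuousOn dd (Set.Ici 0))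
    (hωC : ContinuousOn ωd (Set.Ici 0)) (hμC : ContinuousOn μd (Set.Ici 0))
    (hθC : ContinuousOn θhd (Set.Ici 0)) (hPC : ContinuousOn Pd (Set.Ici 0))
    -- DPPD dynamics (without line limits)
    (hdynη : ∀ t ≥ (0:ℝ), ∀ i, IsMinOn
      (fun x : ℝ => f2 i x + (1 / 2) * (x - (d t i - κ * η t i)) ^ 2) Set.univ
      (ηd t i + d t i))
    (hdynd : ∀ t ≥ (0:ℝ), ∀ i, dd t i =
      max (dlo i) (min (dhi i)
        (d t i - deriv (f0 i) (d t i) + κ * η t i + ω t i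
          + (Pin - d t - D.mulVec (ω t) - C.mulVec (P t)) i + μ t i
          + (Pin - d t - (C * B * Cᵀ).mulVec (θh t)) i)) - d t i)
    (hdynθ : ∀ t ≥ (0:ℝ),
      θhd t = (C * B * Cᵀ).mulVec (μ t + (Pin - d t - (C * B * Cᵀ).mulVec (θh t))))
    (hdynP : ∀ t ≥ (0:ℝ),
      Pd t = Cᵀ.mulVec (ω t + (Pin - d t - D.mulVec (ω t) - C.mulVec (P t))))
    (hdynω : ∀ t ≥ (0:ℝ),
      ωd t = (1 / 2 : ℝ) • (Pin - d t - D.mulVec (ω t) - C.mulVec (P t)))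
    (hdynμ : ∀ t ≥ (0:ℝ),
      μd t = (1 / 2 : ℝ) • (Pin - d t - (C * B * Cᵀ).mulVec (θh t)))
    -- initial feasibility
    (hd0 : ∀ i, d 0 i ∈ Set.Icc (dlo i) (dhi i))
    -- existence of an interior feasible load profile
    (hfeasible : ∃ (dt θt : Fin n → ℝ),
      (∀ i, dlo i < dt i ∧ dt i < dhi i) ∧ Pin - dt - (C * B * Cᵀ).mulVec θt = 0) :
    ∃ (ηs ds θhs ωs μs : Fin n → ℝ) (Ps : Fin l → ℝ),
      -- convergence of the trajectory
      Tendsto η atTop (nhds ηs) ∧ Tendsto d atTop (nhds ds) ∧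
      Tendsto θh atTop (nhds θhs) ∧ Tendsto P atTop (nhds Ps) ∧
      Tendsto ω atTop (nhds ωs) ∧ Tendsto μ atTop (nhds μs) ∧
      -- the limit is an equilibrium: all right-hand sides vanish
      (∀ i, IsMinOn
        (fun x : ℝ => f2 i x + (1 / 2) * (x - (ds i - κ * ηs i)) ^ 2) Set.univ (ds i)) ∧
      (∀ i, ds i =
        max (dlo i) (min (dhi i)
          (ds i - deriv (f0 i) (ds i) + κ * ηs i + ωs i
            + (Pin - ds - D.mulVec ωs - C.mulVec Ps) i + μs i
            + (Pin - ds - (C * B * Cᵀ).mulVec θhs) i))) ∧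
      (C * B * Cᵀ).mulVec (μs + (Pin - ds - (C * B * Cᵀ).mulVec θhs)) = 0 ∧
      Cᵀ.mulVec (ωs + (Pin - ds - D.mulVec ωs - C.mulVec Ps)) = 0 ∧
      Pin - ds - D.mulVec ωs - C.mulVec Ps = 0 ∧
      Pin - ds - (C * B * Cᵀ).mulVec θhs = 0 ∧
      -- frequency restoration
      ωs = 0 ∧
      -- optimality for the problem without line limits
      ((∀ i, ds i ∈ Set.Icc (dlo i) (dhi i)) ∧
        ∀ (d' θh' ω' : Fin n → ℝ) (P' : Fin l → ℝ),
          (∀ i, d' i ∈ Set.Icc (dlo i) (dhi i)) →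
          Pin - d' - D.mulVec ω' - C.mulVec P' = 0 →
          Pin - d' - (C * B * Cᵀ).mulVec θh' = 0 →
          (∑ i, (f0 i (ds i) + f2 i (ds i))) + (1 / 2) * (ωs ⬝ᵥ D.mulVec ωs) ≤
            (∑ i, (f0 i (d' i) + f2 i (d' i))) + (1 / 2) * (ω' ⬝ᵥ D.mulVec ω')) := by
  classical
  set L := C * B * Cᵀ with hLdef
  have hLs : Lᵀ = L := dp_symm C hBdiag
  have hκ0 := hκ.1
  set u1 : ℝ → Fin n → ℝ := fun t => Pin - d t - D.mulVec (ω t) - C.mulVec (P t) with hu1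
  set u2 : ℝ → Fin n → ℝ := fun t => Pin - d t - L.mulVec (θh t) with hu2
  let Dd : Fin n → ℝ := fun i => D i i
  have hDm : ∀ x i, D.mulVec x i = Dd i * x i := fun x i => dp_diag hDdiag x i
  set W : ℝ → ℝ := fun t => (∑ i, (dd t i ^ 2 + (1 - (1 + κ) ^ 2 / 4) * ηd t i ^ 2
    + 1 / 2 * u1 t i ^ 2 + Dd i * ω t i ^ 2
      + 1 / 2 * u2 t i ^ 2 + θhd t i ^ 2)) + ∑ j, Pd t j ^ 2 with hWdef
  have hc0 : 0 < 1 - (1 + κ) ^ 2 / 4 := by nlinarith [hκ.1, hκ.2]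
  have pW1 : ∀ t, ∀ i ∈ Finset.univ, 0 ≤ dd t i ^ 2 + (1 - (1 + κ) ^ 2 / 4) * ηd t i ^ 2
    + 1 / 2 * u1 t i ^ 2 + Dd i * ω t i ^ 2
      + 1 / 2 * u2 t i ^ 2 + θhd t i ^ 2 := by
    intro t i _
    have := (hDpos i)
    positivity
  have pW2 : ∀ t, ∀ j ∈ Finset.univ, 0 ≤ Pd t j ^ 2 := fun t j _ => sq_nonneg _
  have hW0 : ∀ t ≥ (0:ℝ), 0 ≤ W t := fun t _ =>
    add_nonneg (Finset.sum_nonneg (pW1 t)) (Finset.sum_nonneg (pW2 t))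
  -- Lyapunov decrease
  have step : ∀ ηs ds θs μs Ps, DPEq C L Pin dlo dhi f0 f2 κ ηs ds θs μs Ps →
      AntitoneOn (fun t => dpV κ f0 Dd ηs ds θs μs Ps (η t) (d t) (θh t) (ω t) (μ t)
        (u1 t) (u2 t) (P t)) (Set.Ici 0) ∧ ∀ T ε : ℝ, 0 < ε → ∃ t ≥ T, 0 ≤ t ∧ W t < ε := by
    intro ηs ds θs μs Ps hE
    refine dp_decay (fun t ht => (dpV_coord hκ hβ hDpos hf0sc ηs ds θs μs Ps _ _ _ _ _ _ _ _
      le_rfl).1) hW0 fun t ht => ?_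
    have du1 : HasDerivWithinAt u1 (-dd t - D.mulVec (ωd t) - C.mulVec (Pd t)) (Set.Ici 0) t := by
      have := (((hdD t ht).const_sub Pin).sub (dp_mulVec_deriv D (hωD t ht))).sub
        (dp_mulVec_deriv C (hPD t ht))
      exact this
    have du2 : HasDerivWithinAt u2 (-dd t - L.mulVec (θhd t)) (Set.Ici 0) t := by
      have := ((hdD t ht).const_sub Pin).sub (dp_mulVec_deriv L (hθD t ht))
      exact this
    have hω' : ∀ i, ωd t i = 1 / 2 * u1 t i := fun i => by rw [hdynω t ht]; rfl
    have hμ' : ∀ i, μd t i = 1 / 2 * u2 t i := fun i => by rw [hdynμ t ht]; rfl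
    refine ⟨_, dpV_deriv hf0diff ηs ds θs μs Ps (hηD t ht) (hdD t ht) (hθD t ht) (hωD t ht)
      (hμD t ht) du1 du2 (hPD t ht) hω' hμ', ?_⟩
    have b1 : ∀ i, Pin i = ds i + C.mulVec Ps i := fun i => by
      have := congrFun hE.bal1 i
      simp only [Pi.sub_apply, Pi.zero_apply] at this
      linarith
    have b2 : ∀ i, Pin i = ds i + L.mulVec θs i := fun i => by
      have := congrFun hE.bal2 i
      simp only [Pi.sub_apply, Pi.zero_apply] at this
      linarith
    refine dp_lyap (C := C) (L := L) hLs hβ (κ := κ) (Dd := Dd) (δ := fun i => d t i - ds i)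
      (η := fun i => η t i - ηs i)
      (e := ηd t) (v := dd t) (F := fun i => deriv (f0 i) (d t i) - deriv (f0 i) (ds i))
      (ω := ω t) (u1 := u1 t) (μ := fun i => μ t i - μs i) (u2 := u2 t)
      (θ := fun i => θh t i - θs i) (θd := θhd t) (P := fun j => P t j - Ps j) (Pd := Pd t)
      hDpos ?_ ?_ ?_ ?_ ?_ ?_ ?_ ?_ ?_
    · intro i
      have h1 := dp_prox (hf2conv i) (hdynη t ht i) (ds i)
      have h2 := hE.sub i (ηd t i + d t i)
      nlinarith
    · intro i
      have h0 := hdynd t ht i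
      obtain ⟨hq, hqi⟩ := dp_proj (hbox i) (q := dd t i + d t i) (by rw [h0, sub_add_cancel])
      have h1 := hqi (ds i) (hE.mem i)
      have h2 := hE.nrm i _ hq
      change (d t i - deriv (f0 i) (d t i) + κ * η t i + ω t i + u1 t i + μ t i + u2 t i
        - (dd t i + d t i)) * _ ≤ 0 at h1
      nlinarith
    · intro i
      exact dp_deriv_mono (hf0sc i) _ _
    · intro i
      have : (fun j => P t j - Ps j) = P t - Ps := rfl
      rw [this, Matrix.mulVec_sub]
      simp only [hu1, Pi.sub_apply, hDm]
      linarith [b1 i]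
    · intro i
      have : (fun j => θh t j - θs j) = θh t - θs := rfl
      rw [this, Matrix.mulVec_sub]
      simp only [hu2, Pi.sub_apply]
      linarith [b2 i]
    · intro i
      simp only [Pi.sub_apply, Pi.neg_apply, hDm, hω']
    · intro i
      simp only [Pi.sub_apply, Pi.neg_apply]
    · exact hdynP t ht
    · rw [hdynθ t ht]
      have : (fun j => μ t j - μs j) = μ t - μs := rfl
      rw [this, sub_add_eq_add_sub, Matrix.mulVec_sub, hE.mu, sub_zero]
  -- boundedness
  obtain ⟨ηe, de, θe, μe, Pe, hEe⟩ := dp_exists_eq hn hker hBdiag hBpos hβ hf0diff hf0sc hf2conv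
    hκ hfeasible
  obtain ⟨hanti, hWs⟩ := step _ _ _ _ _ hEe
  let z : ℝ → (Fin n → ℝ) × (Fin n → ℝ) × (Fin n → ℝ) × (Fin l → ℝ) × (Fin n → ℝ) × (Fin n → ℝ) :=
    fun t => (η t, d t, θh t, P t, ω t, μ t)
  set V0 := dpV κ f0 Dd ηe de θe μe Pe (η 0) (d 0) (θh 0) (ω 0) (μ 0) (u1 0) (u2 0) (P 0) with hV0
  set R := √(2 * V0 / κ) + √(2 * V0) with hR
  have hbdd : ∀ t ≥ (0:ℝ), z t ∈ Metric.closedBall (ηe, de, θe, Pe, (0 : Fin n → ℝ), μe) R := by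
    intro t ht
    obtain ⟨hv, h1, h2⟩ := dpV_coord hκ hβ hDpos hf0sc ηe de θe μe Pe _ _ _ _ _ _ _ _
      (hanti (Set.mem_Ici.2 le_rfl) ht ht)
    have r0 : √(2 * V0) ≤ R := by rw [hR]; linarith [Real.sqrt_nonneg (2 * V0 / κ)]
    have R0 : 0 ≤ R := (Real.sqrt_nonneg _).trans r0
    simp only [z, Metric.mem_closedBall, Prod.dist_eq, max_le_iff]
    refine ⟨?_, ?_, ?_, ?_, ?_, ?_⟩ <;> rw [dist_pi_le_iff R0] <;> intro i <;> rw [Real.dist_eq]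
    · exact (h1 i).1
    · exact (h1 i).2.1.trans r0
    · exact (h1 i).2.2.2.1.trans r0
    · exact (h2 i).trans r0
    · rw [Pi.zero_apply, sub_zero]; exact (h1 i).2.2.1.trans r0
    · exact (h1 i).2.2.2.2.trans r0
  -- a sequence of times along which the derivatives vanish
  choose τ hτ1 hτ0 hτW using fun k : ℕ => hWs k (1 / ((k:ℝ) + 1)) (by positivity)
  obtain ⟨zs, -, φ, hφ, hz⟩ := tendsto_subseq_of_bounded Metric.isBounded_closedBall
    (x := fun k => z (τ k)) (fun k => hbdd _ (hτ0 k))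
  obtain ⟨ηs, ds, θs, Ps, ωs, μs⟩ := zs
  have hWlim : Tendsto (fun k => W (τ (φ k))) atTop (nhds 0) := by
    refine squeeze_zero (fun k => hW0 _ (hτ0 _)) (fun k => (hτW (φ k)).le) ?_
    exact tendsto_one_div_add_atTop_nhds_zero_nat.comp hφ.tendsto_atTop
  have sq0 : ∀ (c : ℝ) (x : ℕ → ℝ), 0 < c → (∀ k, c * x k ^ 2 ≤ W (τ (φ k))) →
      Tendsto x atTop (nhds 0) := by
    intro c x hc hx
    have h1 : Tendsto (fun k => √(W (τ (φ k)) / c)) atTop (nhds 0) := by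
      have := (hWlim.div_const c).sqrt
      simpa using this
    refine squeeze_zero_norm (fun k => ?_) h1
    rw [Real.norm_eq_abs]
    refine Real.abs_le_sqrt ?_
    rw [le_div_iff₀ hc]
    linarith [hx k]
  have hWi : ∀ t i, dd t i ^ 2 + (1 - (1 + κ) ^ 2 / 4) * ηd t i ^ 2
    + 1 / 2 * u1 t i ^ 2 + Dd i * ω t i ^ 2
      + 1 / 2 * u2 t i ^ 2 + θhd t i ^ 2 ≤ W t := by
    intro t i
    have h1 := Finset.single_le_sum (pW1 t) (Finset.mem_univ i)
    have h2 := Finset.sum_nonneg (pW2 t)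
    simp only [hWdef]
    linarith
  have hWj : ∀ t j, Pd t j ^ 2 ≤ W t := by
    intro t j
    have h1 := Finset.single_le_sum (pW2 t) (Finset.mem_univ j)
    have h2 := Finset.sum_nonneg (pW1 t)
    simp only [hWdef]
    linarith
  have parts : ∀ t i, dd t i ^ 2 ≤ W t ∧ (1 - (1 + κ) ^ 2 / 4) * ηd t i ^ 2 ≤ W t ∧
      1 / 2 * u1 t i ^ 2 ≤ W t ∧ Dd i * ω t i ^ 2 ≤ W t ∧ 1 / 2 * u2 t i ^ 2 ≤ W t ∧
      θhd t i ^ 2 ≤ W t := by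
    intro t i
    have h := hWi t i
    have b1 := sq_nonneg (dd t i)
    have b2 := mul_nonneg hc0.le (sq_nonneg (ηd t i))
    have b3 := sq_nonneg (u1 t i)
    have b4 : 0 ≤ Dd i * ω t i ^ 2 := mul_nonneg (hDpos i).le (sq_nonneg (ω t i))
    have b5 := sq_nonneg (u2 t i)
    have b6 := sq_nonneg (θhd t i)
    refine ⟨?_, ?_, ?_, ?_, ?_, ?_⟩ <;> linarith
  set σ : ℕ → ℝ := fun k => τ (φ k) with hσ
  have hσ0 : ∀ k, 0 ≤ σ k := fun k => hτ0 _
  have ldd : ∀ i, Tendsto (fun k => dd (σ k) i) atTop (nhds 0) := fun i =>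
    sq0 1 _ one_pos fun k => by rw [one_mul]; exact (parts _ i).1
  have lηd : ∀ i, Tendsto (fun k => ηd (σ k) i) atTop (nhds 0) := fun i =>
    sq0 _ _ hc0 fun k => (parts _ i).2.1
  have lu1 : ∀ i, Tendsto (fun k => u1 (σ k) i) atTop (nhds 0) := fun i =>
    sq0 (1 / 2) _ (by norm_num) fun k => (parts _ i).2.2.1
  have lω0 : ∀ i, Tendsto (fun k => ω (σ k) i) atTop (nhds 0) := fun i =>
    sq0 (Dd i) _ (hDpos i) fun k => (parts _ i).2.2.2.1
  have lu2 : ∀ i, Tendsto (fun k => u2 (σ k) i) atTop (nhds 0) := fun i =>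
    sq0 (1 / 2) _ (by norm_num) fun k => (parts _ i).2.2.2.2.1
  have lθd : ∀ i, Tendsto (fun k => θhd (σ k) i) atTop (nhds 0) := fun i =>
    sq0 1 _ one_pos fun k => by rw [one_mul]; exact (parts _ i).2.2.2.2.2
  have lη : Tendsto (fun k => η (σ k)) atTop (nhds ηs) := (continuous_fst.tendsto _).comp hz
  have hz2 := (continuous_snd.tendsto _).comp hz
  have ld : Tendsto (fun k => d (σ k)) atTop (nhds ds) := (continuous_fst.tendsto _).comp hz2
  have hz3 := (continuous_snd.tendsto _).comp hz2
  have lθ : Tendsto (fun k => θh (σ k)) atTop (nhds θs) := (continuous_fst.tendsto _).comp hz3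
  have hz4 := (continuous_snd.tendsto _).comp hz3
  have lP : Tendsto (fun k => P (σ k)) atTop (nhds Ps) := (continuous_fst.tendsto _).comp hz4
  have hz5 := (continuous_snd.tendsto _).comp hz4
  have lω : Tendsto (fun k => ω (σ k)) atTop (nhds ωs) := (continuous_fst.tendsto _).comp hz5
  have lμ : Tendsto (fun k => μ (σ k)) atTop (nhds μs) := (continuous_snd.tendsto _).comp hz5
  have cM : ∀ {a b : ℕ} (M : Matrix (Fin a) (Fin b) ℝ), Continuous (fun x => M.mulVec x) :=
    fun M => (LinearMap.toContinuousLinearMap M.mulVecLin).continuous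
  have hωs : ωs = 0 := tendsto_nhds_unique lω (tendsto_pi_nhds.2 lω0)
  have lu1v : Tendsto (fun k => u1 (σ k)) atTop (nhds 0) := tendsto_pi_nhds.2 lu1
  have lu2v : Tendsto (fun k => u2 (σ k)) atTop (nhds 0) := tendsto_pi_nhds.2 lu2
  have hb1 : Pin - ds - D.mulVec ωs - C.mulVec Ps = 0 := by
    refine tendsto_nhds_unique ?_ lu1v
    exact ((ld.const_sub Pin).sub (((cM D).tendsto _).comp lω)).sub (((cM C).tendsto _).comp lP)
  have hb2 : Pin - ds - L.mulVec θs = 0 := by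
    refine tendsto_nhds_unique ?_ lu2v
    exact (ld.const_sub Pin).sub (((cM L).tendsto _).comp lθ)
  have hLμ : L.mulVec μs = 0 := by
    have h1 : Tendsto (fun k => θhd (σ k)) atTop (nhds 0) := tendsto_pi_nhds.2 lθd
    refine tendsto_nhds_unique ?_ h1
    have h2 := ((cM L).tendsto _).comp (lμ.add lu2v)
    rw [add_zero] at h2
    refine h2.congr fun k => ?_
    rw [hdynθ _ (hσ0 k)]
    rfl
  have lηi := tendsto_pi_nhds.1 lη
  have ldi := tendsto_pi_nhds.1 ld
  have lμi := tendsto_pi_nhds.1 lμ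
  have hprox : ∀ i, IsMinOn
        (fun x : ℝ => f2 i x + (1 / 2) * (x - (ds i - κ * ηs i)) ^ 2) Set.univ (ds i) := by
    intro i y _
    have hgc : Continuous (f2 i) := by
      rw [← continuousOn_univ]; exact (hf2conv i).continuousOn isOpen_univ
    have l1 : Tendsto (fun k => ηd (σ k) i + d (σ k) i) atTop (nhds (ds i)) := by
      simpa using (lηd i).add (ldi i)
    have l2 : Tendsto (fun k => d (σ k) i - κ * η (σ k) i) atTop (nhds (ds i - κ * ηs i)) :=
      (ldi i).sub ((lηi i).const_mul κ)
    have l3 := ((hgc.tendsto _).comp l1).add (((l1.sub l2).pow 2).const_mul (1 / 2))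
    have l4 := (((tendsto_const_nhds (x := y)).sub l2).pow 2).const_mul (1 / 2) |>.const_add (f2 i y)
    exact le_of_tendsto_of_tendsto' l3 l4 fun k => hdynη _ (hσ0 k) i (Set.mem_univ y)
  have hproj : ∀ i, ds i =
        max (dlo i) (min (dhi i)
          (ds i - deriv (f0 i) (ds i) + κ * ηs i + ωs i
            + (Pin - ds - D.mulVec ωs - C.mulVec Ps) i + μs i
            + (Pin - ds - L.mulVec θs) i)) := by
    intro i
    rw [hb1, hb2]
    have hdc := dp_deriv_cont hβ (hf0diff i) (hf0sc i)
    have l1 := (((((((ldi i).sub ((hdc.tendsto _).comp (ldi i))).add ((lηi i).const_mul κ)).add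
      (tendsto_pi_nhds.1 lω i)).add (lu1 i)).add (lμi i)).add (lu2 i))
    have l2 := ((tendsto_const_nhds (x := dlo i)).max
      ((tendsto_const_nhds (x := dhi i)).min l1)).sub (ldi i)
    have l3 := tendsto_nhds_unique (l2.congr fun k => (hdynd _ (hσ0 k) i).symm) (ldd i)
    exact (sub_eq_zero.1 l3).symm
  have hE : DPEq C L Pin dlo dhi f0 f2 κ ηs ds θs μs Ps := by
    refine ⟨?_, ?_, ?_, hLμ, ?_, hb2⟩
    · intro i y
      have := dp_prox (hf2conv i) (hprox i) y
      linarith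
    · intro i
      exact (dp_proj (hbox i) (hproj i)).1
    · intro i y hy
      have := (dp_proj (hbox i) (hproj i)).2 y hy
      rw [hb1, hb2, hωs] at this
      simp only [Pi.zero_apply] at this
      nlinarith
    · rw [hωs] at hb1
      simpa using hb1
  obtain ⟨hanti', -⟩ := step _ _ _ _ _ hE
  set V : ℝ → ℝ := fun t => dpV κ f0 Dd ηs ds θs μs Ps (η t) (d t) (θh t) (ω t) (μ t)
        (u1 t) (u2 t) (P t) with hVdef
  have hVnn : ∀ t, 0 ≤ V t := fun t => (dpV_coord hκ hβ hDpos hf0sc ηs ds θs μs Ps _ _ _ _ _ _ _ _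
      le_rfl).1
  have hVk : Tendsto (fun k => V (σ k)) atTop (nhds 0) := by
    have lθi := tendsto_pi_nhds.1 lθ
    have lPi := tendsto_pi_nhds.1 lP
    have : Tendsto (fun k => V (σ k)) atTop (nhds (dpV κ f0 Dd ηs ds θs μs Ps ηs ds θs 0 μs
        0 0 Ps)) := by
      simp only [hVdef, dpV]
      refine Tendsto.add (tendsto_finsetSum _ fun i _ => ?_) (tendsto_finsetSum _ fun j _ => ?_)
      · have a1 := (lηi i).sub_const (ηs i)
        have a2 := (ldi i).sub_const (ds i)
        have a3 := (lθi i).sub_const (θs i)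
        have a4 := lω0 i
        have a5 := (lμi i).sub_const (μs i)
        have a6 := lu1 i
        have a7 := lu2 i
        have a8 := ((hf0diff i).continuous.tendsto _).comp (ldi i)
        have := (((((a1.pow 2).const_mul (κ / 2)).add ((a2.pow 2).const_mul (1 / 2))).add
          ((a8.sub_const (f0 i (ds i))).sub (a2.const_mul (deriv (f0 i) (ds i))))).sub
          ((a1.mul a2).const_mul κ)).add
          ((((a4.mul a6).add ((a6.pow 2).const_mul (1 / 2))).add (a4.pow 2)).add
            ((a4.pow 2).const_mul (3 / 2 * Dd i)))
        exact this.add ((((a5.mul a7).add ((a7.pow 2).const_mul (1 / 2))).add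
          ((a3.pow 2).const_mul (1 / 2))).add (a5.pow 2))
      · exact (((lPi j).sub_const (Ps j)).pow 2).const_mul (1 / 2)
    have h0 : dpV κ f0 Dd ηs ds θs μs Ps ηs ds θs 0 μs 0 0 Ps = 0 := by
      simp [dpV]
    rwa [h0] at this
  have hVlim : Tendsto V atTop (nhds 0) := by
    rw [Metric.tendsto_atTop]
    intro ε hε
    obtain ⟨k, hk⟩ := (hVk.eventually (gt_mem_nhds hε)).exists
    refine ⟨σ k, fun t ht => ?_⟩
    rw [Real.dist_eq, sub_zero, abs_of_nonneg (hVnn t)]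
    exact (hanti' (hσ0 k) ((hσ0 k).trans ht) ht).trans_lt hk
  have hco := fun t => (dpV_coord hκ hβ hDpos hf0sc ηs ds θs μs Ps (η t) (d t) (θh t) (ω t) (μ t)
        (u1 t) (u2 t) (P t) le_rfl).2
  have r1 : Tendsto (fun t => √(2 * V t)) atTop (nhds 0) := by
    simpa using (hVlim.const_mul 2).sqrt
  have r2 : Tendsto (fun t => √(2 * V t / κ) + √(2 * V t)) atTop (nhds 0) := by
    simpa using (((hVlim.const_mul 2).div_const κ).sqrt).add r1
  have conv : ∀ {m : ℕ} (x : ℝ → Fin m → ℝ) (xs : Fin m → ℝ) (r : ℝ → ℝ),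
      Tendsto r atTop (nhds 0) → (∀ t i, |x t i - xs i| ≤ r t) → Tendsto x atTop (nhds xs) := by
    intro m x xs r hr hx
    refine tendsto_pi_nhds.2 fun i => ?_
    rw [tendsto_iff_dist_tendsto_zero]
    exact squeeze_zero (fun _ => dist_nonneg) (fun t => hx t i) hr
  refine ⟨ηs, ds, θs, ωs, μs, Ps, conv _ _ _ r2 fun t i => ((hco t).1 i).1,
    conv _ _ _ r1 fun t i => ((hco t).1 i).2.1, conv _ _ _ r1 fun t i => ((hco t).1 i).2.2.2.1,
    conv _ _ _ r1 fun t i => ((hco t).2 i),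
    conv _ _ _ r1 fun t i => by rw [hωs, Pi.zero_apply, sub_zero]; exact ((hco t).1 i).2.2.1,
    conv _ _ _ r1 fun t i => ((hco t).1 i).2.2.2.2, hprox, hproj, ?_, ?_, hb1, hb2, hωs, hE.mem, ?_⟩
  · rw [hb2, add_zero, hLμ]
  · rw [hb1, hωs, add_zero, Matrix.mulVec_zero]
  · intro d' θ' ω' P' hd' hbal1 hbal2
    -- the multiplier is orthogonal to the feasible directions
    have hmu : ∑ i, μs i * (d' i - ds i) = 0 := by
      have e : ∀ i, d' i - ds i = L.mulVec (θs - θ') i := by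
        intro i
        have h1 := congrFun hb2 i
        have h2 := congrFun hbal2 i
        simp only [Pi.sub_apply, Pi.zero_apply, Matrix.mulVec_sub] at h1 h2 ⊢
        linarith
      simp only [e]
      rw [dp_dot, hLs, hLμ]
      simp
    have hq : 0 ≤ ω' ⬝ᵥ D.mulVec ω' := by
      refine Finset.sum_nonneg fun i _ => ?_
      rw [hDm]
      have := hDpos i
      have h2 : 0 ≤ Dd i * ω' i ^ 2 := mul_nonneg this.le (sq_nonneg _)
      nlinarith
    have hsum : ∑ i, (f0 i (ds i) + f2 i (ds i) + μs i * (d' i - ds i))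
        ≤ ∑ i, (f0 i (d' i) + f2 i (d' i)) := by
      refine Finset.sum_le_sum fun i _ => ?_
      have h1 := hE.sub i (d' i)
      have h2 := hE.nrm i (d' i) (hd' i)
      have h3 := hf0sc i (ds i) (d' i)
      have h4 : 0 ≤ β * (d' i - ds i) ^ 2 := mul_nonneg (by linarith) (sq_nonneg _)
      linarith
    rw [Finset.sum_add_distrib, hmu] at hsum
    rw [hωs, zero_dotProduct]
    linarith
end
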